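/- Main convergence theorem: let u_ε denote, for each ε > 0, the ε-stochastic (equivalently ε-mean value) solution with boundary data F. Then the upper and lower half-relaxed limits coincide, ū = u̲ =: u, the function u is the unique viscosity solution of the Dirichlet problem D_p u = 0 in Ω with u = F on ∂Ω (u continuous on closure(Ω), a viscosity subsolution and supersolution in Ω, equal to F on ∂Ω), and u_ε → u uniformly on closure(Ω) as ε → 0. -/

import Mathlib

open MeasureTheory Metric Set Filter
open scoped ENNReal NNReal Classical Topology

noncomputable section

abbrev EucN (N : ℕ) := EuclideanSpace ℝ (Fin N)

variable {N : ℕ}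

/-- The directional mean value operator `M^ε_ξ v (x)`. -/
def mveOp (q ε : ℝ) (v : EucN N → ℝ) (ξ x : EucN N) : ℝ :=
  q * (⨍ y in ball x ε, v y) + (1 - q) * ((v (x + ε • ξ) + v (x - ε • ξ)) / 2)

/-- The mean value operator `M^ε v (x) = sup_{|ξ|=1} M^ε_ξ v (x)`. -/
def mvOp (q ε : ℝ) (v : EucN N → ℝ) (x : EucN N) : ℝ :=
  ⨆ ξ : sphere (0 : EucN N) 1, mveOp q ε v (ξ : EucN N) x

/-- `Ω_ε = {x : dist(x,Ω) ≤ ε}`. -/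
def Oeps (Ω : Set (EucN N)) (ε : ℝ) : Set (EucN N) := {x | Metric.infDist x Ω ≤ ε}

/-- `Γ_ε = Ω_ε \ closure Ω`. -/
def Geps (Ω : Set (EucN N)) (ε : ℝ) : Set (EucN N) := Oeps Ω ε \ closure Ω

/-- `v` is an `ε`-mean value solution with boundary data `F`. -/
def IsMVS (q ε : ℝ) (Ω : Set (EucN N)) (F v : EucN N → ℝ) : Prop :=
  Measurable v ∧ (∃ C, ∀ x ∈ Oeps Ω ε, |v x| ≤ C) ∧ EqOn v F (Geps Ω ε) ∧
    LowerSemicontinuousOn v (closure Ω) ∧ ∀ x ∈ closure Ω, v x = mvOp q ε v x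

/-- exterior corkscrew condition, satisfied by bounded Lipschitz domains -/
def Corkscrew (Ω : Set (EucN N)) (δbar μ : ℝ) : Prop :=
  ∀ δ, 0 < δ → δ < δbar → ∀ y ∈ frontier Ω, ∃ z, closedBall z (μ * δ) ⊆ ball y δ \ Ω

/-- upper half-relaxed limit of the family `(u_ε)` -/
def ubarF (Ω : Set (EucN N)) (u : ℝ → EucN N → ℝ) (x : EucN N) : ℝ :=
  ⨅ δ : Ioi (0 : ℝ),
    sSup {r | ∃ ε y, 0 < ε ∧ ε < (δ : ℝ) ∧ y ∈ closure Ω ∧ dist y x ≤ (δ : ℝ) ∧ r = u ε y}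

/-- lower half-relaxed limit of the family `(u_ε)` -/
def ulowF (Ω : Set (EucN N)) (u : ℝ → EucN N → ℝ) (x : EucN N) : ℝ :=
  ⨆ δ : Ioi (0 : ℝ),
    sInf {r | ∃ ε y, 0 < ε ∧ ε < (δ : ℝ) ∧ y ∈ closure Ω ∧ dist y x ≤ (δ : ℝ) ∧ r = u ε y}

/-- The quadratic form of the Hessian of `v` at `x` evaluated at `ξ`. -/
def hessQF (v : EucN N → ℝ) (x ξ : EucN N) : ℝ := iteratedFDeriv ℝ 2 v x ![ξ, ξ]

/-- The dominative p-Laplacian `D_p v (x) = Δv(x) + (p-2) λ_max (D²v(x))`. -/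
def domLap (p : ℝ) (v : EucN N → ℝ) (x : EucN N) : ℝ :=
  (∑ i : Fin N, hessQF v x (EuclideanSpace.single i 1)) +
    (p - 2) * ⨆ ξ : sphere (0 : EucN N) 1, hessQF v x (ξ : EucN N)

/-- viscosity subsolution of `D_p w = 0` on `Ω` -/
def IsViscSubsol (p : ℝ) (Ω : Set (EucN N)) (w : EucN N → ℝ) : Prop :=
  ∀ x₀ ∈ Ω, ∀ φ : EucN N → ℝ, ContDiffOn ℝ 2 φ Ω → φ x₀ = w x₀ →
    (∀ x ∈ Ω, x ≠ x₀ → w x < φ x) → 0 ≤ domLap p φ x₀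

/-- viscosity supersolution of `D_p w = 0` on `Ω` -/
def IsViscSupersol (p : ℝ) (Ω : Set (EucN N)) (w : EucN N → ℝ) : Prop :=
  ∀ x₀ ∈ Ω, ∀ φ : EucN N → ℝ, ContDiffOn ℝ 2 φ Ω → φ x₀ = w x₀ →
    (∀ x ∈ Ω, x ≠ x₀ → φ x < w x) → domLap p φ x₀ ≤ 0

lemma hessQF_eq_fderiv (φ : EucN N → ℝ) (x v : EucN N) :
    hessQF φ x v = fderiv ℝ (fderiv ℝ φ) x v v := by
  simp [hessQF, iteratedFDeriv_two_apply]

lemma hasDerivAt_line {φ : EucN N → ℝ} {x v : EucN N} {t : ℝ}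
    (hφ : ContDiffAt ℝ 2 φ (x + t • v)) :
    HasDerivAt (fun s : ℝ => φ (x + s • v)) (fderiv ℝ φ (x + t • v) v) t := by
  have h1 : HasFDerivAt φ (fderiv ℝ φ (x + t • v)) (x + t • v) :=
    (hφ.differentiableAt (by norm_num)).hasFDerivAt
  have h2 : HasDerivAt (fun s : ℝ => x + s • v) v t := by
    simpa using ((hasDerivAt_id t).smul_const v).const_add x
  exact h1.comp_hasDerivAt t h2

lemma hasDerivAt_fderiv_apply_line {E : Type*} [NormedAddCommGroup E] [NormedSpace ℝ E]
    {φ : E → ℝ} {x v : E} {t : ℝ} (hφ : ContDiffAt ℝ 2 φ (x + t • v)) :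
    HasDerivAt (fun s : ℝ => fderiv ℝ φ (x + s • v) v)
      (fderiv ℝ (fderiv ℝ φ) (x + t • v) v v) t := by
  have h0 : ContDiffAt ℝ 1 (fderiv ℝ φ) (x + t • v) :=
    hφ.fderiv_right (m := 1) (by norm_num)
  have h1 : HasFDerivAt (fderiv ℝ φ) (fderiv ℝ (fderiv ℝ φ) (x + t • v)) (x + t • v) :=
    (h0.differentiableAt (by norm_num)).hasFDerivAt
  have h2 : HasDerivAt (fun s : ℝ => x + s • v) v t := by
    simpa using ((hasDerivAt_id t).smul_const v).const_add x
  have h3 := h1.comp_hasDerivAt t h2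
  exact (ContinuousLinearMap.apply ℝ ℝ v).hasFDerivAt.comp_hasDerivAt t h3

lemma hasDerivAt_fderiv_line {φ : EucN N → ℝ} {x v : EucN N} {t : ℝ}
    (hφ : ContDiffAt ℝ 2 φ (x + t • v)) :
    HasDerivAt (fun s : ℝ => fderiv ℝ φ (x + s • v) v) (hessQF φ (x + t • v) v) t := by
  rw [hessQF_eq_fderiv]
  exact hasDerivAt_fderiv_apply_line hφ

/-- Symmetric second differences are controlled by the Hessian along the segment. -/
lemma abs_secondDiff_sub_le {φ : EucN N → ℝ} {x v : EucN N} {c σ : ℝ}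
    (hφ : ∀ t ∈ Icc (-1 : ℝ) 1, ContDiffAt ℝ 2 φ (x + t • v))
    (hσ : ∀ t ∈ Icc (-1 : ℝ) 1, |hessQF φ (x + t • v) v - c| ≤ σ) :
    |φ (x + v) + φ (x - v) - 2 * φ x - c| ≤ σ := by
  set g : ℝ → ℝ := fun s => fderiv ℝ φ (x + s • v) v with hg
  have hI : ∀ t ∈ Icc (0 : ℝ) 1, t ∈ Icc (-1 : ℝ) 1 ∧ -t ∈ Icc (-1 : ℝ) 1 := by
    intro t ht
    constructor <;> constructor <;> linarith [ht.1, ht.2]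
  have hneg : ∀ t : ℝ, HasDerivAt (fun s : ℝ => -s) (-1) t := fun t => hasDerivAt_neg t
  have hG : ∀ t ∈ Icc (0 : ℝ) 1, HasDerivAt
      (fun s : ℝ => φ (x + s • v) + φ (x + (-s) • v) - 2 * φ x - c * s ^ 2)
      (g t - g (-t) - 2 * c * t) t := by
    intro t ht
    have h1 := hasDerivAt_line (hφ t (hI t ht).1)
    have h2 := (hasDerivAt_line (hφ (-t) (hI t ht).2)).comp t (hneg t)
    have h3 := ((hasDerivAt_id t).pow 2).const_mul c
    refine (((h1.add h2).sub_const (2 * φ x)).sub h3).congr_deriv ?_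
    simp [hg]; ring
  have hG' : ∀ t ∈ Icc (0 : ℝ) 1, HasDerivAt (fun s : ℝ => g s - g (-s) - 2 * c * s)
      (hessQF φ (x + t • v) v + hessQF φ (x + (-t) • v) v - 2 * c) t := by
    intro t ht
    have h1 := hasDerivAt_fderiv_line (hφ t (hI t ht).1)
    have h2 := (hasDerivAt_fderiv_line (hφ (-t) (hI t ht).2)).comp t (hneg t)
    have h3 := (hasDerivAt_id t).const_mul (2 * c)
    refine ((h1.sub h2).sub h3).congr_deriv ?_
    simp
  have hb1 : ∀ t ∈ Icc (0 : ℝ) 1, ‖g t - g (-t) - 2 * c * t‖ ≤ 2 * σ * t := by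
    refine image_norm_le_of_norm_deriv_right_le_deriv_boundary (B' := fun _ => 2 * σ)
      (f' := fun t => hessQF φ (x + t • v) v + hessQF φ (x + (-t) • v) v - 2 * c)
      (fun t ht => (hG' t ht).continuousAt.continuousWithinAt)
      (fun t ht => (hG' t ⟨ht.1, ht.2.le⟩).hasDerivWithinAt) (by simp)
      (fun t => by simpa using (hasDerivAt_id t).const_mul (2 * σ)) ?_
    intro t ht
    have h1 := abs_le.1 (hσ t (hI t ⟨ht.1, ht.2.le⟩).1)
    have h2 := abs_le.1 (hσ (-t) (hI t ⟨ht.1, ht.2.le⟩).2)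
    rw [Real.norm_eq_abs, abs_le]
    constructor <;> linarith [h1.1, h1.2, h2.1, h2.2]
  have hb2 : ∀ t ∈ Icc (0 : ℝ) 1,
      ‖φ (x + t • v) + φ (x + (-t) • v) - 2 * φ x - c * t ^ 2‖ ≤ σ * t ^ 2 := by
    refine image_norm_le_of_norm_deriv_right_le_deriv_boundary (B' := fun t => 2 * σ * t)
      (f' := fun t => g t - g (-t) - 2 * c * t)
      (fun t ht => (hG t ht).continuousAt.continuousWithinAt)
      (fun t ht => (hG t ⟨ht.1, ht.2.le⟩).hasDerivWithinAt) (by simp; ring)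
      (fun t => ?_) (fun t ht => hb1 t ⟨ht.1, ht.2.le⟩)
    refine (((hasDerivAt_id t).pow 2).const_mul σ).congr_deriv ?_
    simp; ring
  have := hb2 1 (by simp)
  simpa [sub_eq_add_neg] using this

lemma contDiffAt_eventually_line {φ : EucN N → ℝ} {x : EucN N} (hφ : ContDiffAt ℝ 2 φ x) :
    ∀ᶠ y in 𝓝 x, ContDiffAt ℝ 2 φ y := hφ.eventually (by simp)

lemma eventually_norm_fderiv_fderiv_sub_lt {E : Type*} [NormedAddCommGroup E]
    [NormedSpace ℝ E] {φ : E → ℝ} {x : E} (hφ : ContDiffAt ℝ 2 φ x) {σ : ℝ} (hσ : 0 < σ) :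
    ∀ᶠ y in 𝓝 x, ‖fderiv ℝ (fderiv ℝ φ) y - fderiv ℝ (fderiv ℝ φ) x‖ < σ := by
  have h0 : ContDiffAt ℝ 1 (fderiv ℝ φ) x := hφ.fderiv_right (m := 1) (by norm_num)
  have h1 : ContinuousAt (fderiv ℝ (fderiv ℝ φ)) x :=
    (h0.fderiv_right (m := 0) (by norm_num)).continuousAt
  have h2 := (tendsto_iff_norm_sub_tendsto_zero (E := E →L[ℝ] E →L[ℝ] ℝ)).1 h1
  exact h2.eventually (gt_mem_nhds hσ)

/-- Local uniform control of the Hessian quadratic form near a point. -/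
lemma exists_ball_hess {φ : EucN N → ℝ} {x : EucN N} (hφ : ContDiffAt ℝ 2 φ x) {σ : ℝ}
    (hσ : 0 < σ) :
    ∃ R > 0, ∀ y ∈ ball x R, ContDiffAt ℝ 2 φ y ∧
      ∀ v, |hessQF φ y v - hessQF φ x v| ≤ σ * ‖v‖ ^ 2 := by
  have h1 := contDiffAt_eventually_line hφ
  have h2 := eventually_norm_fderiv_fderiv_sub_lt hφ hσ
  obtain ⟨R, hR, h⟩ := Metric.eventually_nhds_iff_ball.1 (h1.and h2)
  refine ⟨R, hR, fun y hy => ⟨(h y hy).1, fun v => ?_⟩⟩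
  rw [hessQF_eq_fderiv, hessQF_eq_fderiv, ← sub_apply,
    ← sub_apply, ← Real.norm_eq_abs]
  refine (ContinuousLinearMap.le_opNorm₂ _ v v).trans ?_
  have := (h y hy).2.le
  rw [mul_assoc, ← sq]
  gcongr

lemma hessQF_smul (φ : EucN N → ℝ) (x v : EucN N) (t : ℝ) :
    hessQF φ x (t • v) = t ^ 2 * hessQF φ x v := by
  simp [hessQF_eq_fderiv]; ring

/-- The Hessian quadratic form as a limit of symmetric second difference quotients. -/
lemma tendsto_secondDiff {φ : EucN N → ℝ} {x : EucN N} (hφ : ContDiffAt ℝ 2 φ x)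
    (v : EucN N) :
    Tendsto (fun t : ℝ => (φ (x + t • v) + φ (x - t • v) - 2 * φ x) / t ^ 2) (𝓝[≠] 0)
      (𝓝 (hessQF φ x v)) := by
  rw [Metric.tendsto_nhds]
  intro η hη
  have hp : 0 < ‖v‖ ^ 2 + 1 := by positivity
  obtain ⟨R, hR, h⟩ := exists_ball_hess hφ (σ := η / 2 / (‖v‖ ^ 2 + 1)) (by positivity)
  have hev : ∀ᶠ t : ℝ in 𝓝[≠] 0, |t| * (‖v‖ + 1) < R := by
    refine nhdsWithin_le_nhds ?_
    have : Tendsto (fun t : ℝ => |t| * (‖v‖ + 1)) (𝓝 0) (𝓝 (|0| * (‖v‖ + 1))) :=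
      (Continuous.tendsto (by fun_prop) 0)
    simp only [abs_zero, zero_mul] at this
    exact this.eventually (gt_mem_nhds hR)
  filter_upwards [hev, self_mem_nhdsWithin] with t ht ht0
  have ht0 : t ≠ 0 := ht0
  have hmem : ∀ s ∈ Icc (-1 : ℝ) 1, x + s • (t • v) ∈ ball x R := by
    intro s hs
    have hs' : |s| ≤ 1 := abs_le.2 hs
    rw [mem_ball, dist_eq_norm, add_sub_cancel_left, norm_smul, norm_smul, Real.norm_eq_abs,
      Real.norm_eq_abs]
    calc |s| * (|t| * ‖v‖) ≤ 1 * (|t| * (‖v‖ + 1)) := by gcongr; linarith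
      _ < R := by linarith
  have key := abs_secondDiff_sub_le (φ := φ) (x := x) (v := t • v) (c := hessQF φ x (t • v))
    (σ := η / 2 / (‖v‖ ^ 2 + 1) * ‖t • v‖ ^ 2) (fun s hs => (h _ (hmem s hs)).1)
    (fun s hs => (h _ (hmem s hs)).2 _)
  rw [hessQF_smul] at key
  have ht2 : 0 < t ^ 2 := by positivity
  rw [Real.dist_eq, show (φ (x + t • v) + φ (x - t • v) - 2 * φ x) / t ^ 2 - hessQF φ x v
    = (φ (x + t • v) + φ (x - t • v) - 2 * φ x - t ^ 2 * hessQF φ x v) / t ^ 2 by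
      field_simp, abs_div, abs_of_pos ht2, div_lt_iff₀ ht2]
  refine key.trans_lt ?_
  rw [norm_smul, mul_pow, Real.norm_eq_abs, sq_abs]
  have : η / 2 / (‖v‖ ^ 2 + 1) * ‖v‖ ^ 2 < η := by
    rw [div_mul_eq_mul_div, div_lt_iff₀ hp]; nlinarith [sq_nonneg ‖v‖]
  nlinarith

lemma hessQF_eq_of_tendsto {φ : EucN N → ℝ} {x v : EucN N} {l : ℝ} (hφ : ContDiffAt ℝ 2 φ x)
    (h : Tendsto (fun t : ℝ => (φ (x + t • v) + φ (x - t • v) - 2 * φ x) / t ^ 2) (𝓝[≠] 0)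
      (𝓝 l)) : hessQF φ x v = l :=
  tendsto_nhds_unique (tendsto_secondDiff hφ v) h

lemma hessQF_add {φ ψ : EucN N → ℝ} {x : EucN N} (hφ : ContDiffAt ℝ 2 φ x)
    (hψ : ContDiffAt ℝ 2 ψ x) (v : EucN N) :
    hessQF (fun y => φ y + ψ y) x v = hessQF φ x v + hessQF ψ x v := by
  refine hessQF_eq_of_tendsto (hφ.add hψ) ?_
  refine ((tendsto_secondDiff hφ v).add (tendsto_secondDiff hψ v)).congr fun t => ?_
  rw [← add_div]; ring

lemma hessQF_const_mul {φ : EucN N → ℝ} {x : EucN N} (hφ : ContDiffAt ℝ 2 φ x) (a : ℝ)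
    (v : EucN N) : hessQF (fun y => a * φ y) x v = a * hessQF φ x v := by
  refine hessQF_eq_of_tendsto (contDiffAt_const.mul hφ) ?_
  refine ((tendsto_secondDiff hφ v).const_mul a).congr fun t => ?_
  rw [← mul_div_assoc]; ring

lemma hessQF_add_const (φ : EucN N → ℝ) (a : ℝ) (x v : EucN N) :
    hessQF (fun y => φ y + a) x v = hessQF φ x v := by
  have h : fderiv ℝ (fun y => φ y + a) = fderiv ℝ φ := by
    funext y
    exact fderiv_add_const a
  rw [hessQF_eq_fderiv, hessQF_eq_fderiv, h]

lemma contDiff_normSq_sub (z : EucN N) : ContDiff ℝ 2 (fun y : EucN N => ‖y - z‖ ^ 2) :=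
  (contDiff_id.sub contDiff_const).norm_sq ℝ

lemma norm_add_sub_sq (x z v : EucN N) (t : ℝ) :
    ‖x + t • v - z‖ ^ 2 = ‖x - z‖ ^ 2 + 2 * t * inner ℝ (x - z) v + t ^ 2 * ‖v‖ ^ 2 := by
  rw [show x + t • v - z = (x - z) + t • v by abel, norm_add_sq_real, inner_smul_right,
    norm_smul, mul_pow, Real.norm_eq_abs, sq_abs]
  ring

lemma norm_sub_sub_sq (x z v : EucN N) (t : ℝ) :
    ‖x - t • v - z‖ ^ 2 = ‖x - z‖ ^ 2 - 2 * t * inner ℝ (x - z) v + t ^ 2 * ‖v‖ ^ 2 := by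
  have := norm_add_sub_sq x z v (-t)
  rw [neg_smul, ← sub_eq_add_neg] at this
  rw [this]; ring

lemma hessQF_normSq (z x v : EucN N) :
    hessQF (fun y => ‖y - z‖ ^ 2) x v = 2 * ‖v‖ ^ 2 := by
  refine hessQF_eq_of_tendsto (contDiff_normSq_sub z).contDiffAt ?_
  refine tendsto_const_nhds.congr' ?_
  filter_upwards [self_mem_nhdsWithin] with t ht
  have ht : t ≠ 0 := ht
  rw [norm_add_sub_sq, norm_sub_sub_sq]
  field_simp
  ring

lemma contDiff_quartic (z : EucN N) :
    ContDiff ℝ 2 (fun y : EucN N => (‖y - z‖ ^ 2) ^ 2) := (contDiff_normSq_sub z).pow 2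

lemma hessQF_quartic (x v : EucN N) :
    hessQF (fun y => (‖y - x‖ ^ 2) ^ 2) x v = 0 := by
  refine hessQF_eq_of_tendsto (contDiff_quartic x).contDiffAt ?_
  have h : Tendsto (fun t : ℝ => 2 * t ^ 2 * ‖v‖ ^ 4) (𝓝[≠] 0) (𝓝 (2 * 0 ^ 2 * ‖v‖ ^ 4)) :=
    (Continuous.tendsto (by fun_prop) 0).mono_left nhdsWithin_le_nhds
  simp only [ne_eq, OfNat.ofNat_ne_zero, not_false_eq_true, zero_pow, mul_zero, zero_mul] at h
  refine h.congr' ?_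
  filter_upwards [self_mem_nhdsWithin] with t ht
  have ht : t ≠ 0 := ht
  rw [norm_add_sub_sq, norm_sub_sub_sq]
  simp
  field_simp
  ring

/-- At a local maximum the Hessian is nonpositive. -/
lemma hessQF_nonpos_of_isLocalMax {φ : EucN N → ℝ} {x : EucN N} (hφ : ContDiffAt ℝ 2 φ x)
    (hmax : IsLocalMax φ x) (v : EucN N) : hessQF φ x v ≤ 0 := by
  refine le_of_tendsto (tendsto_secondDiff hφ v) ?_
  refine nhdsWithin_le_nhds ?_
  have h1 : Tendsto (fun t : ℝ => x + t • v) (𝓝 0) (𝓝 x) := by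
    have : Continuous fun t : ℝ => x + t • v := by fun_prop
    simpa using this.tendsto 0
  have h2 : Tendsto (fun t : ℝ => x - t • v) (𝓝 0) (𝓝 x) := by
    have : Continuous fun t : ℝ => x - t • v := by fun_prop
    simpa using this.tendsto 0
  filter_upwards [h1.eventually hmax, h2.eventually hmax] with t ht1 ht2
  exact div_nonpos_of_nonpos_of_nonneg (by linarith) (by positivity)

lemma integral_ball_linearIsometry (e : EucN N ≃ₗᵢ[ℝ] EucN N) (g : EucN N → ℝ) (ε : ℝ) :
    ∫ y in ball (0 : EucN N) ε, g (e y) = ∫ y in ball (0 : EucN N) ε, g y := by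
  have h := e.measurePreserving.setIntegral_preimage_emb e.toHomeomorph.measurableEmbedding g
    (ball 0 ε)
  have h2 : (e : EucN N → EucN N) ⁻¹' ball 0 ε = ball 0 ε := by
    ext y; simp
  rwa [h2] at h

lemma integral_ball_translate (x : EucN N) (g : EucN N → ℝ) (ε : ℝ) :
    ∫ y in ball x ε, g y = ∫ y in ball (0 : EucN N) ε, g (x + y) := by
  have h := (measurePreserving_add_left (volume : Measure (EucN N)) x).setIntegral_preimage_emb
    (measurableEmbedding_addLeft x) g (ball x ε)
  have h2 : (fun y => x + y) ⁻¹' ball x ε = ball 0 ε := by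
    ext y; simp
  rw [h2] at h
  exact h.symm

lemma integral_ball_neg (g : EucN N → ℝ) (ε : ℝ) :
    ∫ y in ball (0 : EucN N) ε, g (-y) = ∫ y in ball (0 : EucN N) ε, g y :=
  integral_ball_linearIsometry (LinearIsometryEquiv.neg ℝ) g ε

lemma integrableOn_ball_of_continuous {g : EucN N → ℝ} (hg : Continuous g) (x : EucN N) (ε : ℝ) :
    IntegrableOn g (ball x ε) :=
  (hg.continuousOn.integrableOn_compact (isCompact_closedBall x ε)).mono_set
    ball_subset_closedBall

lemma integral_ball_coord_mul_of_ne {i j : Fin N} (hij : i ≠ j) (ε : ℝ) :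
    ∫ y in ball (0 : EucN N) ε, y i * y j = 0 := by
  have h := integral_ball_linearIsometry
    (LinearIsometryEquiv.piLpCongrRight 2 (fun k : Fin N =>
      if k = i then LinearIsometryEquiv.neg ℝ (E := ℝ) else LinearIsometryEquiv.refl ℝ ℝ))
    (fun y : EucN N => y i * y j) ε
  simp only [LinearIsometryEquiv.piLpCongrRight_apply, if_true, if_neg hij.symm,
    LinearIsometryEquiv.coe_neg, LinearIsometryEquiv.coe_refl, id_eq] at h
  rw [show (fun y : EucN N => -y i * y j) = fun y => -(y i * y j) by ext y; ring,
    integral_neg] at h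
  linarith

lemma integral_ball_coord_sq_eq (i j : Fin N) (ε : ℝ) :
    ∫ y in ball (0 : EucN N) ε, y i * y i = ∫ y in ball (0 : EucN N) ε, y j * y j := by
  have h := integral_ball_linearIsometry
    (LinearIsometryEquiv.piLpCongrLeft 2 ℝ ℝ (Equiv.swap i j))
    (fun y : EucN N => y j * y j) ε
  simpa [LinearIsometryEquiv.piLpCongrLeft_apply] using h

lemma measureReal_ball_pos (x : EucN N) {ε : ℝ} (hε : 0 < ε) :
    0 < (volume : Measure (EucN N)).real (ball x ε) :=
  ENNReal.toReal_pos (measure_ball_pos _ _ hε).ne' measure_ball_lt_top.ne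

lemma integral_ball_normSq (hN : 2 ≤ N) {ε : ℝ} (hε : 0 < ε) :
    ∫ y in ball (0 : EucN N) ε, ‖y‖ ^ 2 =
      (volume : Measure (EucN N)).real (ball 0 ε) * (N * ε ^ 2 / (N + 2)) := by
  have : Nonempty (Fin N) := ⟨⟨0, by omega⟩⟩
  have h := integral_fun_norm_addHaar (volume : Measure (EucN N))
    (fun r : ℝ => (Iio ε).indicator (fun r => r ^ 2) r)
  have h1 : (fun y : EucN N => (Iio ε).indicator (fun r : ℝ => r ^ 2) ‖y‖) =
      (ball (0 : EucN N) ε).indicator (fun y => ‖y‖ ^ 2) := by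
    ext y; simp [indicator]
  rw [h1, integral_indicator measurableSet_ball] at h
  have h2 : ∫ y in Ioi (0 : ℝ), y ^ (Module.finrank ℝ (EucN N) - 1) •
      (Iio ε).indicator (fun r : ℝ => r ^ 2) y = ε ^ (N + 2) / (N + 2) := by
    have : ∀ y : ℝ, y ^ (Module.finrank ℝ (EucN N) - 1) • (Iio ε).indicator
        (fun r : ℝ => r ^ 2) y = (Iio ε).indicator (fun r : ℝ => r ^ (N + 1)) y := by
      intro y
      by_cases hy : y ∈ Iio ε
      · simp only [hy, indicator_of_mem, finrank_euclideanSpace, Fintype.card_fin, smul_eq_mul]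
        rw [← pow_add]; congr 1; omega
      · simp [hy]
    simp_rw [this]
    rw [setIntegral_indicator measurableSet_Iio, Ioi_inter_Iio, ← integral_Ioc_eq_integral_Ioo,
      ← intervalIntegral.integral_of_le hε.le, integral_pow]
    simp; ring
  rw [h2] at h
  rw [h]
  have h3 : (volume : Measure (EucN N)).real (ball 0 ε) =
      ε ^ N * (volume : Measure (EucN N)).real (ball 0 1) := by
    simp only [Measure.real]
    rw [Measure.addHaar_ball _ _ hε.le, ENNReal.toReal_mul, ENNReal.toReal_ofReal (by positivity),
      finrank_euclideanSpace, Fintype.card_fin]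
  rw [h3]
  simp only [finrank_euclideanSpace, Fintype.card_fin, smul_eq_mul, nsmul_eq_mul]
  ring

lemma integral_ball_coord_sq (hN : 2 ≤ N) {ε : ℝ} (hε : 0 < ε) (i : Fin N) :
    ∫ y in ball (0 : EucN N) ε, y i * y i =
      (volume : Measure (EucN N)).real (ball 0 ε) * (ε ^ 2 / (N + 2)) := by
  have h := integral_ball_normSq hN hε
  have h1 : ∫ y in ball (0 : EucN N) ε, ‖y‖ ^ 2 =
      ∑ j : Fin N, ∫ y in ball (0 : EucN N) ε, y j * y j := by
    rw [← integral_finsetSum]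
    · refine integral_congr_ae (Eventually.of_forall fun y => ?_)
      simp only [EuclideanSpace.real_norm_sq_eq]
      simp [sq]
    · intro j _
      exact integrableOn_ball_of_continuous (by fun_prop) _ _
  rw [h1, Finset.sum_congr rfl fun j _ => integral_ball_coord_sq_eq j i ε] at h
  simp only [Finset.sum_const, Finset.card_univ, Fintype.card_fin, nsmul_eq_mul] at h
  have hN' : (N : ℝ) ≠ 0 := by positivity
  have : (N : ℝ) * ∫ y in ball (0 : EucN N) ε, y i * y i = N *
      ((volume : Measure (EucN N)).real (ball 0 ε) * (ε ^ 2 / (N + 2))) := by rw [h]; ring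
  exact mul_left_cancel₀ hN' this

lemma hessQF_eq_sum (φ : EucN N → ℝ) (x y : EucN N) :
    hessQF φ x y = ∑ i, ∑ j, (y i * y j) * fderiv ℝ (fderiv ℝ φ) x
      (EuclideanSpace.single i 1) (EuclideanSpace.single j 1) := by
  rw [hessQF_eq_fderiv]
  have hy : y = ∑ i, y i • EuclideanSpace.single i (1 : ℝ) := by
    have := (EuclideanSpace.basisFun (Fin N) ℝ).sum_repr y
    simpa using this.symm
  generalize fderiv ℝ (fderiv ℝ φ) x = B
  conv_lhs => rw [hy]
  simp only [map_sum, map_smul, sum_apply, smul_apply, smul_eq_mul]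
  rw [Finset.sum_comm]
  simp only [Finset.mul_sum]
  refine Finset.sum_congr rfl fun i _ => Finset.sum_congr rfl fun j _ => ?_
  ring

lemma continuous_hessQF (φ : EucN N → ℝ) (x : EucN N) : Continuous (hessQF φ x) := by
  have : hessQF φ x = fun y => _ := funext (hessQF_eq_sum φ x)
  rw [this]
  fun_prop

lemma setAverage_hessQF (hN : 2 ≤ N) {ε : ℝ} (hε : 0 < ε) (φ : EucN N → ℝ) (x : EucN N) :
    ⨍ y in ball (0 : EucN N) ε, hessQF φ x y =
      ε ^ 2 / (N + 2) * ∑ i : Fin N, hessQF φ x (EuclideanSpace.single i 1) := by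
  have hv := measureReal_ball_pos (0 : EucN N) hε
  rw [setAverage_eq, smul_eq_mul, inv_mul_eq_iff_eq_mul₀ hv.ne']
  simp_rw [hessQF_eq_sum φ x]
  rw [integral_finsetSum _ fun i _ => integrableOn_ball_of_continuous (by fun_prop) _ _]
  rw [Finset.mul_sum, Finset.mul_sum]
  refine Finset.sum_congr rfl fun i _ => ?_
  rw [integral_finsetSum _ fun i _ => integrableOn_ball_of_continuous (by fun_prop) _ _,
    Finset.sum_eq_single i]
  · rw [integral_mul_const, integral_ball_coord_sq hN hε i, Finset.sum_eq_single i]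
    · rw [Finset.sum_eq_single i]
      · simp; ring
      · intro b _ hb; simp [hb]
      · simp
    · intro b _ hb; simp [hb]
    · simp
  · intro j _ hj
    rw [integral_mul_const, integral_ball_coord_mul_of_ne hj.symm, zero_mul]
  · simp

/-- The linear operator `Δφ + (p-2) ∂²φ/∂ξ²`, evaluated at `x`. -/
def dirLap (p : ℝ) (φ : EucN N → ℝ) (x ξ : EucN N) : ℝ :=
  (∑ i : Fin N, hessQF φ x (EuclideanSpace.single i 1)) + (p - 2) * hessQF φ x ξ

lemma bddAbove_hessQF_sphere (φ : EucN N → ℝ) (x : EucN N) :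
    BddAbove (range fun ξ : sphere (0 : EucN N) 1 => hessQF φ x (ξ : EucN N)) := by
  have h := (isCompact_sphere (0 : EucN N) 1).bddAbove_image (continuous_hessQF φ x).continuousOn
  rwa [image_eq_range] at h

lemma dirLap_le_domLap {p : ℝ} (hp : 2 ≤ p) (φ : EucN N → ℝ) (x : EucN N) {ξ : EucN N}
    (hξ : ‖ξ‖ = 1) : dirLap p φ x ξ ≤ domLap p φ x := by
  have h := le_ciSup (bddAbove_hessQF_sphere φ x) ⟨ξ, by simpa using hξ⟩
  simp only [dirLap, domLap]
  have := mul_le_mul_of_nonneg_left h (sub_nonneg.2 hp)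
  linarith

lemma exists_norm_eq_one (hN : 2 ≤ N) : ∃ ξ : EucN N, ‖ξ‖ = 1 :=
  ⟨EuclideanSpace.single ⟨0, by omega⟩ 1, by simp⟩

lemma domLap_le (hN : 2 ≤ N) {p : ℝ} (hp : 2 ≤ p) {φ : EucN N → ℝ} {x : EucN N} {B : ℝ}
    (h : ∀ ξ : EucN N, ‖ξ‖ = 1 → dirLap p φ x ξ ≤ B) : domLap p φ x ≤ B := by
  obtain ⟨ξ₀, hξ₀⟩ := exists_norm_eq_one hN
  have : Nonempty (sphere (0 : EucN N) 1) := ⟨⟨ξ₀, by simp [hξ₀]⟩⟩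
  rw [domLap, Real.mul_iSup_of_nonneg (sub_nonneg.2 hp)]
  have : (⨆ ξ : sphere (0 : EucN N) 1, (p - 2) * hessQF φ x (ξ : EucN N)) ≤
      B - ∑ i : Fin N, hessQF φ x (EuclideanSpace.single i 1) := by
    refine ciSup_le fun ξ => ?_
    have := h ξ (by simp)
    simp only [dirLap] at this
    linarith
  linarith

lemma dirLap_add {p : ℝ} {φ ψ : EucN N → ℝ} {x : EucN N} (hφ : ContDiffAt ℝ 2 φ x)
    (hψ : ContDiffAt ℝ 2 ψ x) (ξ : EucN N) :
    dirLap p (fun y => φ y + ψ y) x ξ = dirLap p φ x ξ + dirLap p ψ x ξ := by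
  simp only [dirLap, hessQF_add hφ hψ, Finset.sum_add_distrib]; ring

lemma dirLap_const_mul {p : ℝ} {φ : EucN N → ℝ} {x : EucN N} (hφ : ContDiffAt ℝ 2 φ x)
    (a : ℝ) (ξ : EucN N) : dirLap p (fun y => a * φ y) x ξ = a * dirLap p φ x ξ := by
  simp only [dirLap, hessQF_const_mul hφ, ← Finset.mul_sum]; ring

lemma dirLap_add_const (p : ℝ) (φ : EucN N → ℝ) (a : ℝ) (x ξ : EucN N) :
    dirLap p (fun y => φ y + a) x ξ = dirLap p φ x ξ := by
  simp only [dirLap, hessQF_add_const]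

lemma dirLap_normSq {p : ℝ} (z x : EucN N) {ξ : EucN N} (hξ : ‖ξ‖ = 1) :
    dirLap p (fun y => ‖y - z‖ ^ 2) x ξ = 2 * (N + p - 2) := by
  simp [dirLap, hessQF_normSq, hξ]; ring

lemma dirLap_quartic {p : ℝ} (x ξ : EucN N) :
    dirLap p (fun y => (‖y - x‖ ^ 2) ^ 2) x ξ = 0 := by
  simp [dirLap, hessQF_quartic]

section Operator

variable {q ε : ℝ} {v w : EucN N → ℝ} {x ξ : EucN N}

lemma mveOp_const (hε : 0 < ε) (a : ℝ) : mveOp q ε (fun _ => a) ξ x = a := by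
  have hv := measureReal_ball_pos x hε
  simp only [mveOp, setAverage_eq, setIntegral_const, smul_eq_mul]
  field_simp
  ring

lemma mveOp_add (hv : IntegrableOn v (ball x ε)) (hw : IntegrableOn w (ball x ε)) :
    mveOp q ε (fun y => v y + w y) ξ x = mveOp q ε v ξ x + mveOp q ε w ξ x := by
  simp only [mveOp, setAverage_eq, smul_eq_mul]
  rw [integral_add hv hw]; ring

lemma mveOp_const_mul (a : ℝ) :
    mveOp q ε (fun y => a * v y) ξ x = a * mveOp q ε v ξ x := by
  simp only [mveOp, setAverage_eq, smul_eq_mul, integral_const_mul]; ring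

lemma mveOp_sub (hv : IntegrableOn v (ball x ε)) (hw : IntegrableOn w (ball x ε)) :
    mveOp q ε (fun y => v y - w y) ξ x = mveOp q ε v ξ x - mveOp q ε w ξ x := by
  simp only [mveOp, setAverage_eq, smul_eq_mul]
  rw [integral_sub hv hw]; ring

lemma mveOp_mono (hq0 : 0 ≤ q) (hq1 : q ≤ 1) (hε : 0 < ε) (hξ : ‖ξ‖ = 1)
    (hv : IntegrableOn v (ball x ε)) (hw : IntegrableOn w (ball x ε))
    (h : ∀ y ∈ closedBall x ε, v y ≤ w y) : mveOp q ε v ξ x ≤ mveOp q ε w ξ x := by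
  have hb := measureReal_ball_pos x hε
  have h1 := h (x + ε • ξ) (by simp [norm_smul, hξ, abs_of_pos hε])
  have h2 := h (x - ε • ξ) (by simp [mem_closedBall, norm_smul, hξ, abs_of_pos hε])
  have h3 := setIntegral_mono_on hv hw measurableSet_ball fun y hy =>
    h y (ball_subset_closedBall hy)
  simp only [mveOp, setAverage_eq, smul_eq_mul]
  have h4 := mul_le_mul_of_nonneg_left h3 (inv_nonneg.2 hb.le)
  have h5 := mul_le_mul_of_nonneg_left h4 hq0
  have h6 : (1 - q) * ((v (x + ε • ξ) + v (x - ε • ξ)) / 2) ≤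
      (1 - q) * ((w (x + ε • ξ) + w (x - ε • ξ)) / 2) :=
    mul_le_mul_of_nonneg_left (by linarith) (by linarith)
  linarith

lemma mveOp_le (hq0 : 0 ≤ q) (hq1 : q ≤ 1) (hε : 0 < ε) (hξ : ‖ξ‖ = 1)
    (hv : IntegrableOn v (ball x ε)) {s : ℝ} (h : ∀ y ∈ closedBall x ε, v y ≤ s) :
    mveOp q ε v ξ x ≤ s := by
  rw [← mveOp_const (q := q) (ξ := ξ) (x := x) hε s]
  exact mveOp_mono hq0 hq1 hε hξ hv (integrableOn_const measure_ball_lt_top.ne) h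

lemma mveOp_sub_self (hε : 0 < ε) (hv : IntegrableOn v (ball x ε)) :
    mveOp q ε v ξ x - v x = q / 2 * (⨍ y in ball (0 : EucN N) ε,
      (v (x + y) + v (x - y) - 2 * v x)) +
      (1 - q) / 2 * (v (x + ε • ξ) + v (x - ε • ξ) - 2 * v x) := by
  have hb := measureReal_ball_pos x hε
  have hb0 : (volume : Measure (EucN N)).real (ball 0 ε) =
      (volume : Measure (EucN N)).real (ball x ε) :=
    (Measure.addHaar_real_ball_center volume x ε).symm
  have hp : IntegrableOn (fun y => v (x + y)) (ball 0 ε) := by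
    have h := (measurePreserving_add_left (volume : Measure (EucN N))
      x).integrableOn_comp_preimage (measurableEmbedding_addLeft x) (f := v) (s := ball x ε)
    have h2 : (fun y => x + y) ⁻¹' ball x ε = ball 0 ε := by
      ext y; simp
    rw [h2] at h
    exact h.2 hv
  have hm : IntegrableOn (fun y => v (x - y)) (ball 0 ε) := by
    have h := (Measure.measurePreserving_neg
      (volume : Measure (EucN N))).integrableOn_comp_preimage
      (MeasurableEquiv.neg (EucN N)).measurableEmbedding (f := fun y => v (x + y))
      (s := ball 0 ε)
    have h2 : (Neg.neg : EucN N → EucN N) ⁻¹' ball 0 ε = ball 0 ε := by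
      ext y; simp
    rw [h2] at h
    simpa [Function.comp_def, sub_eq_add_neg] using h.2 hp
  have e1 : ∫ y in ball (0 : EucN N) ε, v (x - y) = ∫ y in ball x ε, v y := by
    rw [integral_ball_translate x, ← integral_ball_neg (fun y => v (x + y))]
    simp only [sub_eq_add_neg]
  simp only [mveOp, setAverage_eq, smul_eq_mul]
  rw [integral_sub (f := fun y => v (x + y) + v (x - y)) (hp.add hm)
    (integrableOn_const measure_ball_lt_top.ne), integral_add hp hm, e1,
    ← integral_ball_translate, setIntegral_const, hb0, smul_eq_mul]
  field_simp
  ring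

end Operator

lemma mveOp_expansion (hN : 2 ≤ N) {p q : ℝ} (hp : 2 ≤ p)
    (hq : q = ((N : ℝ) + 2) / ((N : ℝ) + p)) {φ : EucN N → ℝ} {x₀ x ξ : EucN N} {R σ ε : ℝ}
    (hφ : ∀ y ∈ ball x₀ R, ContDiffAt ℝ 2 φ y ∧
      ∀ v, |hessQF φ y v - hessQF φ x₀ v| ≤ σ * ‖v‖ ^ 2)
    (hε : 0 < ε) (hx : dist x x₀ + ε < R) (hξ : ‖ξ‖ = 1) :
    |mveOp q ε φ ξ x - φ x - ε ^ 2 / (2 * (N + p)) * dirLap p φ x₀ ξ| ≤ σ * ε ^ 2 / 2 := by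
  have hNp : (0 : ℝ) < N + p := by positivity
  have hq0 : 0 ≤ q := by rw [hq]; positivity
  have hq1 : q ≤ 1 := by rw [hq, div_le_one hNp]; linarith
  have hsub : closedBall x ε ⊆ ball x₀ R := by
    intro y hy
    rw [mem_ball]
    have := dist_triangle y x x₀
    rw [mem_closedBall] at hy
    linarith
  have hc : ContinuousOn φ (closedBall x ε) := fun y hy =>
    (hφ y (hsub hy)).1.continuousAt.continuousWithinAt
  have hint : IntegrableOn φ (ball x ε) :=
    (hc.integrableOn_compact (isCompact_closedBall x ε)).mono_set ball_subset_closedBall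
  have hsd : ∀ v : EucN N, ‖v‖ ≤ ε →
      |φ (x + v) + φ (x - v) - 2 * φ x - hessQF φ x₀ v| ≤ σ * ‖v‖ ^ 2 := by
    intro v hv
    have hm : ∀ t ∈ Icc (-1 : ℝ) 1, x + t • v ∈ ball x₀ R := by
      intro t ht
      apply hsub
      have : |t| ≤ 1 := abs_le.2 ht
      simp only [mem_closedBall, dist_self_add_left, norm_smul, Real.norm_eq_abs]
      nlinarith [norm_nonneg v]
    exact abs_secondDiff_sub_le (fun t ht => (hφ _ (hm t ht)).1)
      fun t ht => (hφ _ (hm t ht)).2 v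
  have hσ : 0 ≤ σ := by
    have h1 := hsd (ε • ξ) (by simp [norm_smul, hξ, abs_of_pos hε])
    have h2 := (abs_nonneg _).trans h1
    simp only [norm_smul, hξ, Real.norm_eq_abs, mul_one, sq_abs] at h2
    exact nonneg_of_mul_nonneg_left h2 (by positivity)
  have hb := measureReal_ball_pos (0 : EucN N) hε
  set D : EucN N → ℝ := fun y => φ (x + y) + φ (x - y) - 2 * φ x with hD
  have hDc : IntegrableOn D (ball 0 ε) := by
    have : ContinuousOn D (closedBall 0 ε) := by
      refine ((hc.comp (by fun_prop) ?_).add (hc.comp (by fun_prop) ?_)).sub continuousOn_const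
      · intro y hy; simpa using hy
      · intro y hy; simpa [dist_eq_norm] using hy
    exact (this.integrableOn_compact (isCompact_closedBall 0 ε)).mono_set ball_subset_closedBall
  have hHc : IntegrableOn (hessQF φ x₀) (ball 0 ε) :=
    integrableOn_ball_of_continuous (continuous_hessQF φ x₀) _ _
  have h1 : |(⨍ y in ball (0 : EucN N) ε, D y) - ⨍ y in ball (0 : EucN N) ε, hessQF φ x₀ y| ≤
      σ * ε ^ 2 := by
    simp only [setAverage_eq, smul_eq_mul]
    rw [← mul_sub, ← integral_sub hDc hHc, abs_mul, abs_of_pos (inv_pos.2 hb),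
      inv_mul_le_iff₀ hb, mul_comm]
    refine norm_setIntegral_le_of_norm_le_const (f := fun y => D y - hessQF φ x₀ y)
      measure_ball_lt_top fun y hy => ?_
    have hy : ‖y‖ < ε := by simpa using hy
    refine (hsd y hy.le).trans ?_
    gcongr
  have h2 := hsd (ε • ξ) (by simp [norm_smul, hξ, abs_of_pos hε])
  simp only [norm_smul, hξ, Real.norm_eq_abs, mul_one, sq_abs, hessQF_smul] at h2
  have key : mveOp q ε φ ξ x - φ x - ε ^ 2 / (2 * (N + p)) * dirLap p φ x₀ ξ =
      q / 2 * ((⨍ y in ball (0 : EucN N) ε, D y) - ⨍ y in ball (0 : EucN N) ε, hessQF φ x₀ y) +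
      (1 - q) / 2 * (φ (x + ε • ξ) + φ (x - ε • ξ) - 2 * φ x - ε ^ 2 * hessQF φ x₀ ξ) := by
    rw [mveOp_sub_self hε hint, setAverage_hessQF hN hε, dirLap, hq]
    field_simp
    ring
  rw [key]
  refine (abs_add_le _ _).trans ?_
  rw [abs_mul, abs_mul, abs_of_nonneg (by positivity : 0 ≤ q / 2),
    abs_of_nonneg (by linarith : 0 ≤ (1 - q) / 2)]
  have h3 := mul_le_mul_of_nonneg_left h1 (by positivity : 0 ≤ q / 2)
  have h4 := mul_le_mul_of_nonneg_left h2 (by linarith : 0 ≤ (1 - q) / 2)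
  linarith

lemma exists_ball_mveOp_le (hN : 2 ≤ N) {p q : ℝ} (hp : 2 ≤ p)
    (hq : q = ((N : ℝ) + 2) / ((N : ℝ) + p)) {φ : EucN N → ℝ} {x₀ : EucN N} {c : ℝ}
    (hφ : ContDiffAt ℝ 2 φ x₀) (hc : 0 < c) :
    ∃ r > 0, ∀ x ∈ ball x₀ r, ∀ ε, 0 < ε → ε < r → IntegrableOn φ (ball x ε) ∧
      ∀ ξ : EucN N, ‖ξ‖ = 1 → dirLap p φ x₀ ξ ≤ -c → mveOp q ε φ ξ x ≤ φ x := by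
  have hNp : (0 : ℝ) < N + p := by positivity
  obtain ⟨R, hR, h⟩ := exists_ball_hess hφ (div_pos hc hNp)
  refine ⟨R / 2, by positivity, fun x hx ε hε hεr => ⟨?_, fun ξ hξ hd => ?_⟩⟩
  · have hc : ContinuousOn φ (closedBall x ε) := fun y hy => by
      refine (h y ?_).1.continuousAt.continuousWithinAt
      have := dist_triangle y x x₀
      rw [mem_closedBall] at hy
      rw [mem_ball] at hx ⊢
      linarith
    exact (hc.integrableOn_compact (isCompact_closedBall x ε)).mono_set ball_subset_closedBall
  · have h1 := mveOp_expansion hN hp hq h hε (by rw [mem_ball] at hx; linarith) hξ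
    have h2 := (abs_le.1 h1).2
    have h3 : ε ^ 2 / (2 * (N + p)) * dirLap p φ x₀ ξ ≤ ε ^ 2 / (2 * (N + p)) * (-c) :=
      mul_le_mul_of_nonneg_left hd (by positivity)
    have h4 : c / (N + p) * ε ^ 2 / 2 = ε ^ 2 / (2 * (N + p)) * c := by field_simp
    linarith

lemma mveOp_normSq (hN : 2 ≤ N) {p q : ℝ} (hp : 2 ≤ p)
    (hq : q = ((N : ℝ) + 2) / ((N : ℝ) + p)) {x ξ : EucN N} {ε : ℝ} (hε : 0 < ε)
    (hξ : ‖ξ‖ = 1) :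
    mveOp q ε (fun y => ‖y‖ ^ 2) ξ x = ‖x‖ ^ 2 + (N + p - 2) / (N + p) * ε ^ 2 := by
  have hNp : (0 : ℝ) < N + p := by positivity
  have h := mveOp_expansion hN hp hq (φ := fun y => ‖y - 0‖ ^ 2) (x₀ := x) (x := x) (R := 2 * ε)
    (σ := 0) (fun y _ => ⟨(contDiff_normSq_sub 0).contDiffAt, fun v => by
      simp only [hessQF_normSq]; simp⟩) hε (by simp; linarith) hξ
  rw [zero_mul, zero_div, dirLap_normSq _ _ hξ] at h
  have h2 := abs_eq_zero.1 (le_antisymm h (abs_nonneg _))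
  simp only [sub_zero] at h2
  have h3 : ε ^ 2 / (2 * (N + p)) * (2 * (N + p - 2)) = (N + p - 2) / (N + p) * ε ^ 2 := by
    field_simp
  linarith

/-- Comparison principle for discrete subsolutions on bounded sets. -/
lemma discrete_comparison (hN : 2 ≤ N) {p q : ℝ} (hp : 2 ≤ p)
    (hq : q = ((N : ℝ) + 2) / ((N : ℝ) + p)) {D : Set (EucN N)} (hD : Bornology.IsBounded D)
    {ε : ℝ} (hε : 0 < ε) {z : EucN N → ℝ} {m : ℝ} (hbdd : BddAbove (z '' D))
    (hint : ∀ x ∈ D, IntegrableOn z (ball x ε))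
    (hz : ∀ x ∈ D, ∀ η > 0, ∃ ξ : EucN N, ‖ξ‖ = 1 ∧ z x ≤ mveOp q ε z ξ x + η)
    (hm : ∀ x ∈ D, ∀ y ∈ closedBall x ε, y ∉ D → z y ≤ m) : ∀ x ∈ D, z x ≤ m := by
  by_contra! hcon
  obtain ⟨xs, hxs, hlt⟩ := hcon
  have hNp : (0 : ℝ) < N + p := by positivity
  have hq0 : 0 ≤ q := by rw [hq]; positivity
  have hq1 : q ≤ 1 := by rw [hq, div_le_one hNp]; linarith
  obtain ⟨R, hR⟩ := hD.exists_norm_le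
  have hR0 : 0 ≤ R := (norm_nonneg _).trans (hR xs hxs)
  set κ : ℝ := (z xs - m) / (R + ε) ^ 2 with hκ
  have hκ0 : 0 < κ := div_pos (by linarith) (by positivity)
  have hκR : κ * (R + ε) ^ 2 = z xs - m := by rw [hκ]; field_simp
  set b : ℝ := (N + p - 2) / (N + p) * ε ^ 2 with hb
  have hN2 : (2 : ℝ) ≤ N := by exact_mod_cast hN
  have hb0 : 0 < b := mul_pos (div_pos (by linarith) hNp) (by positivity)
  set w : EucN N → ℝ := fun y => z y + κ * ‖y‖ ^ 2 with hw
  obtain ⟨C, hC⟩ := hbdd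
  have hwb : BddAbove (w '' D) := by
    refine ⟨C + κ * R ^ 2, ?_⟩
    rintro _ ⟨y, hy, rfl⟩
    have h1 := hC ⟨y, hy, rfl⟩
    have h2 : ‖y‖ ^ 2 ≤ R ^ 2 := by gcongr; exact hR y hy
    have h3 := mul_le_mul_of_nonneg_left h2 hκ0.le
    simp only [hw]; linarith
  set s := sSup (w '' D) with hs
  have hle : ∀ y ∈ D, w y ≤ s := fun y hy => le_csSup hwb ⟨y, hy, rfl⟩
  have hzs : z xs ≤ s := by
    have := hle xs hxs
    have h2 : 0 ≤ κ * ‖xs‖ ^ 2 := by positivity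
    simp only [hw] at this; linarith
  have hstep : ∀ x ∈ D, w x ≤ s - κ * b / 2 := by
    intro x hx
    obtain ⟨ξ, hξ, h1⟩ := hz x hx (κ * b / 2) (by positivity)
    have hsq : IntegrableOn (fun y : EucN N => κ * ‖y‖ ^ 2) (ball x ε) :=
      integrableOn_ball_of_continuous (by fun_prop) _ _
    have h2 : mveOp q ε w ξ x ≤ s := by
      refine mveOp_le hq0 hq1 hε hξ ((hint x hx).add hsq) fun y hy => ?_
      by_cases hyD : y ∈ D
      · exact hle y hyD
      · have h3 := hm x hx y hy hyD
        have h4 : ‖y‖ ≤ R + ε := by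
          have h5 : ‖y - x‖ ≤ ε := by simpa [dist_eq_norm] using hy
          have := norm_le_norm_add_norm_sub' y x
          have := hR x hx
          linarith
        have h5 : κ * ‖y‖ ^ 2 ≤ κ * (R + ε) ^ 2 := by gcongr
        change z y + κ * ‖y‖ ^ 2 ≤ s
        linarith
    have h3 : mveOp q ε w ξ x = mveOp q ε z ξ x + κ * (‖x‖ ^ 2 + b) := by
      rw [hw, mveOp_add (hint x hx) hsq, mveOp_const_mul, mveOp_normSq hN hp hq hε hξ]
    simp only [hw] at h2 h3 ⊢
    linarith
  have hs2 : s ≤ s - κ * b / 2 := by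
    refine csSup_le ⟨_, xs, hxs, rfl⟩ ?_
    rintro _ ⟨y, hy, rfl⟩
    exact hstep y hy
  have : 0 < κ * b := by positivity
  linarith

lemma closedBall_subset_Oeps {Ω : Set (EucN N)} {x : EucN N} (hx : x ∈ closure Ω) (ε : ℝ) :
    closedBall x ε ⊆ Oeps Ω ε := by
  intro y hy
  have h1 : infDist y Ω ≤ infDist x Ω + dist y x := infDist_le_infDist_add_dist
  rw [infDist_zero_of_mem_closure hx, zero_add] at h1
  exact h1.trans hy

lemma weight_nonneg_le_one {p q : ℝ} (hp : 2 ≤ p) (hq : q = ((N : ℝ) + 2) / ((N : ℝ) + p)) :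
    0 ≤ q ∧ q ≤ 1 := by
  have hNp : (0 : ℝ) < N + p := by positivity
  constructor
  · rw [hq]; positivity
  · rw [hq, div_le_one hNp]; linarith

section IsMVS

variable {q ε : ℝ} {Ω : Set (EucN N)} {F u : EucN N → ℝ}

lemma IsMVS.integrableOn_ball (hu : IsMVS q ε Ω F u) {x : EucN N} (hx : x ∈ closure Ω) :
    IntegrableOn u (ball x ε) := by
  obtain ⟨hm, ⟨C, hC⟩, -⟩ := hu
  refine Measure.integrableOn_of_bounded (M := C) measure_ball_lt_top.ne
    hm.aestronglyMeasurable ?_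
  filter_upwards [ae_restrict_mem measurableSet_ball] with y hy
  exact hC y (closedBall_subset_Oeps hx ε (ball_subset_closedBall hy))

lemma IsMVS.mveOp_le (hu : IsMVS q ε Ω F u) (hq : 0 ≤ q ∧ q ≤ 1) (hε : 0 < ε) {x ξ : EucN N}
    (hx : x ∈ closure Ω) (hξ : ‖ξ‖ = 1) : mveOp q ε u ξ x ≤ u x := by
  have hint := hu.integrableOn_ball hx
  obtain ⟨-, ⟨C, hC⟩, -, -, h⟩ := hu
  rw [h x hx]
  refine le_ciSup (f := fun ξ : sphere (0 : EucN N) 1 => mveOp q ε u (ξ : EucN N) x) ?_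
    ⟨ξ, by simp [hξ]⟩
  refine ⟨C, ?_⟩
  rintro _ ⟨ζ, rfl⟩
  exact _root_.mveOp_le hq.1 hq.2 hε (by simp) hint fun y hy =>
    (le_abs_self _).trans (hC y (closedBall_subset_Oeps hx ε hy))

lemma IsMVS.exists_le (hN : 2 ≤ N) (hu : IsMVS q ε Ω F u) {x : EucN N} (hx : x ∈ closure Ω)
    {η : ℝ} (hη : 0 < η) : ∃ ξ : EucN N, ‖ξ‖ = 1 ∧ u x ≤ mveOp q ε u ξ x + η := by
  obtain ⟨ξ₀, hξ₀⟩ := exists_norm_eq_one hN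
  have : Nonempty (sphere (0 : EucN N) 1) := ⟨⟨ξ₀, by simp [hξ₀]⟩⟩
  have h : u x - η < mvOp q ε u x := by rw [← hu.2.2.2.2 x hx]; linarith
  obtain ⟨ξ, hξ⟩ := exists_lt_of_lt_ciSup h
  exact ⟨ξ, by simp, by linarith⟩

lemma IsMVS.eq_boundary (hu : IsMVS q ε Ω F u) {x y : EucN N} (hx : x ∈ closure Ω)
    (hy : y ∈ closedBall x ε) (hy' : y ∉ closure Ω) : u y = F y :=
  hu.2.2.1 ⟨closedBall_subset_Oeps hx ε hy, hy'⟩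

lemma IsMVS.abs_le_closure (hu : IsMVS q ε Ω F u) (hε : 0 < ε) :
    ∃ C, ∀ x ∈ closure Ω, |u x| ≤ C := by
  obtain ⟨C, hC⟩ := hu.2.1
  exact ⟨C, fun x hx => hC x (closedBall_subset_Oeps hx ε (mem_closedBall_self hε.le))⟩

/-- Comparison of a mean value solution with a discrete supersolution. -/
lemma IsMVS.sub_le (hu : IsMVS q ε Ω F u) (hN : 2 ≤ N) {p : ℝ} (hp : 2 ≤ p)
    (hq : q = ((N : ℝ) + 2) / ((N : ℝ) + p)) (hε : 0 < ε) (hΩb : Bornology.IsBounded Ω)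
    {D : Set (EucN N)} (hD : D ⊆ closure Ω) {Ψ : EucN N → ℝ} {m B : ℝ}
    (hB : ∀ x ∈ D, B ≤ Ψ x) (hint : ∀ x ∈ D, IntegrableOn Ψ (ball x ε))
    (hΨ : ∀ x ∈ D, ∀ ξ : EucN N, ‖ξ‖ = 1 → mveOp q ε Ψ ξ x ≤ Ψ x)
    (hm : ∀ x ∈ D, ∀ y ∈ closedBall x ε, y ∉ D → u y - Ψ y ≤ m) :
    ∀ x ∈ D, u x - Ψ x ≤ m := by
  obtain ⟨C, hC⟩ := hu.abs_le_closure hε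
  refine discrete_comparison hN hp hq (z := fun x => u x - Ψ x) (hΩb.closure.subset hD) hε
    ?_ (fun x hx => (hu.integrableOn_ball (hD hx)).sub (hint x hx)) ?_ hm
  · refine ⟨C - B, ?_⟩
    rintro _ ⟨x, hx, rfl⟩
    have := (abs_le.1 (hC x (hD hx))).2
    have := hB x hx
    linarith
  · intro x hx η hη
    obtain ⟨ξ, hξ, h⟩ := hu.exists_le hN (hD hx) hη
    refine ⟨ξ, hξ, ?_⟩
    rw [mveOp_sub (hu.integrableOn_ball (hD hx)) (hint x hx)]
    have := hΨ x hx ξ hξ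
    linarith

/-- Comparison of a mean value solution with a discrete subsolution. -/
lemma IsMVS.le_sub (hu : IsMVS q ε Ω F u) (hN : 2 ≤ N) {p : ℝ} (hp : 2 ≤ p)
    (hq : q = ((N : ℝ) + 2) / ((N : ℝ) + p)) (hε : 0 < ε) (hΩb : Bornology.IsBounded Ω)
    {D : Set (EucN N)} (hD : D ⊆ closure Ω) {Ψ : EucN N → ℝ} {m B : ℝ}
    (hB : ∀ x ∈ D, Ψ x ≤ B) (hint : ∀ x ∈ D, IntegrableOn Ψ (ball x ε))
    (hΨ : ∀ x ∈ D, ∃ ξ : EucN N, ‖ξ‖ = 1 ∧ Ψ x ≤ mveOp q ε Ψ ξ x)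
    (hm : ∀ x ∈ D, ∀ y ∈ closedBall x ε, y ∉ D → Ψ y - u y ≤ m) :
    ∀ x ∈ D, Ψ x - u x ≤ m := by
  obtain ⟨C, hC⟩ := hu.abs_le_closure hε
  refine discrete_comparison hN hp hq (z := fun x => Ψ x - u x) (hΩb.closure.subset hD) hε
    ?_ (fun x hx => (hint x hx).sub (hu.integrableOn_ball (hD hx))) ?_ hm
  · refine ⟨B + C, ?_⟩
    rintro _ ⟨x, hx, rfl⟩
    have := (abs_le.1 (hC x (hD hx))).1
    have := hB x hx
    linarith
  · intro x hx η hη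
    obtain ⟨ξ, hξ, h⟩ := hΨ x hx
    refine ⟨ξ, hξ, ?_⟩
    rw [mveOp_sub (hint x hx) (hu.integrableOn_ball (hD hx))]
    have := hu.mveOp_le (weight_nonneg_le_one hp hq) hε (hD hx) hξ
    linarith

end IsMVS

lemma exists_uniform_bound (hN : 2 ≤ N) {p q : ℝ} (hp : 2 ≤ p)
    (hq : q = ((N : ℝ) + 2) / ((N : ℝ) + p)) {Ω : Set (EucN N)}
    (hΩb : Bornology.IsBounded Ω) {F : EucN N → ℝ} {K : ℝ≥0}
    (hF : LipschitzOnWith K F Ωᶜ) (hΩn : Ωᶜ.Nonempty) {u : ℝ → EucN N → ℝ}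
    (hu : ∀ ε : ℝ, 0 < ε → IsMVS q ε Ω F (u ε)) :
    ∃ A, 0 ≤ A ∧ ∀ ε, 0 < ε → ∀ x ∈ closure Ω, |u ε x| ≤ A + K * ε := by
  obtain ⟨y₀, hy₀⟩ := hΩn
  obtain ⟨R, hR0, hR⟩ := hΩb.closure.exists_pos_norm_le
  refine ⟨|F y₀| + K * (R + ‖y₀‖), by positivity, fun ε hε => ?_⟩
  set M := |F y₀| + K * (R + ‖y₀‖) + K * ε with hM
  have hout : ∀ x ∈ closure Ω, ∀ y ∈ closedBall x ε, y ∉ closure Ω → |u ε y| ≤ M := by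
    intro x hx y hy hy'
    rw [(hu ε hε).eq_boundary hx hy hy']
    have h1 := hF.dist_le_mul y (fun h => hy' (subset_closure h)) y₀ hy₀
    have h2 : dist y y₀ ≤ R + ‖y₀‖ + ε := by
      have := dist_triangle y x y₀
      have h3 : dist x y₀ ≤ ‖x‖ + ‖y₀‖ := by rw [dist_eq_norm]; exact norm_sub_le _ _
      have := hR x hx
      rw [mem_closedBall] at hy
      linarith
    have h3 := mul_le_mul_of_nonneg_left h2 K.2
    rw [Real.dist_eq] at h1
    have h4 := abs_sub_abs_le_abs_sub (F y) (F y₀)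
    have h5 : (K : ℝ) * dist y y₀ ≤ K * (R + ‖y₀‖ + ε) := h3
    rw [hM]; linarith
  obtain ⟨ξ₀, hξ₀⟩ := exists_norm_eq_one hN
  intro x hx
  rw [abs_le']
  constructor
  · have := (hu ε hε).sub_le hN hp hq hε hΩb subset_rfl (Ψ := fun _ => 0) (m := M) (B := 0)
      (fun _ _ => le_rfl) (fun _ _ => integrableOn_const measure_ball_lt_top.ne)
      (fun x _ ξ _ => (mveOp_const hε 0).le)
      (fun x hx y hy hy' => by simpa using (abs_le'.1 (hout x hx y hy hy')).1) x hx
    simpa using this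
  · have := (hu ε hε).le_sub hN hp hq hε hΩb subset_rfl (Ψ := fun _ => 0) (m := M) (B := 0)
      (fun _ _ => le_rfl) (fun _ _ => integrableOn_const measure_ball_lt_top.ne)
      (fun x _ => ⟨ξ₀, hξ₀, (mveOp_const hε 0).ge⟩)
      (fun x hx y hy hy' => by simpa using (abs_le'.1 (hout x hx y hy hy')).2) x hx
    simpa using this

lemma hessQF_eq_of_hasDerivAt {φ : EucN N → ℝ} {x v : EucN N} {d : ℝ → ℝ} {c : ℝ}
    (hφ : ContDiffAt ℝ 2 φ x)
    (h1 : ∀ᶠ s in 𝓝 (0 : ℝ), HasDerivAt (fun s : ℝ => φ (x + s • v)) (d s) s)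
    (h2 : HasDerivAt d c 0) : hessQF φ x v = c := by
  have hx : ContDiffAt ℝ 2 φ (x + (0 : ℝ) • v) := by simpa using hφ
  have h3 := hasDerivAt_fderiv_line hx
  simp only [zero_smul, add_zero] at h3
  refine h3.unique (h2.congr_of_eventuallyEq ?_)
  have h4 : Tendsto (fun s : ℝ => x + s • v) (𝓝 0) (𝓝 x) := by
    have : Continuous fun s : ℝ => x + s • v := by fun_prop
    simpa using this.tendsto 0
  filter_upwards [h1, h4.eventually (contDiffAt_eventually_line hφ)] with s hs hs'
  exact (hasDerivAt_line hs').unique hs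

lemma contDiffAt_invNormSqPow (k : ℕ) {x : EucN N} (hx : x ≠ 0) :
    ContDiffAt ℝ 2 (fun y : EucN N => ((‖y‖ ^ 2)⁻¹) ^ k) x :=
  (((contDiff_norm_sq ℝ).contDiffAt).inv (by simpa using hx)).pow k

lemma hessQF_invNormSqPow (k : ℕ) {x : EucN N} (hx : x ≠ 0) (v : EucN N) :
    hessQF (fun y : EucN N => ((‖y‖ ^ 2)⁻¹) ^ (k + 1)) x v =
      4 * (k + 1) * (k + 2) * ((‖x‖ ^ 2)⁻¹) ^ (k + 3) * (inner ℝ x v) ^ 2 -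
        2 * (k + 1) * ((‖x‖ ^ 2)⁻¹) ^ (k + 2) * ‖v‖ ^ 2 := by
  set P : ℝ → ℝ := fun s => ‖x‖ ^ 2 + 2 * s * inner ℝ x v + s ^ 2 * ‖v‖ ^ 2 with hP
  have hPx : ∀ s : ℝ, ‖x + s • v‖ ^ 2 = P s := by
    intro s
    simpa using norm_add_sub_sq x 0 v s
  have hx2 : ‖x‖ ^ 2 ≠ 0 := by simpa using hx
  have hP0 : P 0 = ‖x‖ ^ 2 := by simp [hP]
  have hPc : Continuous P := by fun_prop
  have hne : ∀ᶠ s in 𝓝 (0 : ℝ), P s ≠ 0 := hPc.continuousAt.eventually_ne (by rwa [hP0])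
  set P' : ℝ → ℝ := fun s => 2 * inner ℝ x v + 2 * s * ‖v‖ ^ 2 with hP'
  have hder : ∀ s, HasDerivAt P (P' s) s := by
    intro s
    have h1 := (((hasDerivAt_id s).const_mul 2).mul_const (inner ℝ x v)).const_add (‖x‖ ^ 2)
    have h2 := ((hasDerivAt_id s).pow 2).mul_const (‖v‖ ^ 2)
    exact (h1.add h2).congr_deriv (by simp [hP'])
  have hder' : HasDerivAt P' (2 * ‖v‖ ^ 2) 0 := by
    have h1 := (((hasDerivAt_id (0 : ℝ)).const_mul 2).mul_const (‖v‖ ^ 2)).const_add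
      (2 * inner ℝ x v)
    exact h1.congr_deriv (by simp)
  have hinv : ∀ n : ℕ, ∀ s, P s ≠ 0 →
      HasDerivAt (fun s => ((P s)⁻¹) ^ (n + 1)) (-(n + 1) * ((P s)⁻¹) ^ (n + 2) * P' s) s := by
    intro n s hs
    refine (((hder s).inv hs).pow (n + 1)).congr_deriv ?_
    simp only [Nat.add_sub_cancel, Pi.inv_apply]
    push_cast
    rw [div_eq_mul_inv, ← inv_pow]
    ring
  refine hessQF_eq_of_hasDerivAt (d := fun s => -(k + 1) * ((P s)⁻¹) ^ (k + 2) * P' s)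
    (contDiffAt_invNormSqPow _ hx) ?_ ?_
  · filter_upwards [hne] with s hs
    simp_rw [hPx]
    exact hinv k s hs
  · have h1 := ((hinv (k + 1) 0 (by rwa [hP0])).const_mul (-((k : ℝ) + 1))).mul hder'
    refine h1.congr_deriv ?_
    rw [hP0]
    simp only [hP']
    push_cast
    ring

lemma sum_inner_single_sq (x : EucN N) :
    ∑ i : Fin N, (inner ℝ x (EuclideanSpace.single i (1 : ℝ))) ^ 2 = ‖x‖ ^ 2 := by
  rw [EuclideanSpace.real_norm_sq_eq]
  simp [EuclideanSpace.inner_single_right]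

lemma dirLap_invNormSqPow {p : ℝ} (hp : 2 ≤ p) (k : ℕ) {x : EucN N} (hx : x ≠ 0)
    {ξ : EucN N} (hξ : ‖ξ‖ = 1) :
    2 * (k + 1) * ((‖x‖ ^ 2)⁻¹) ^ (k + 2) * (2 * k + 6 - N - p) ≤
      dirLap p (fun y : EucN N => ((‖y‖ ^ 2)⁻¹) ^ (k + 1)) x ξ := by
  simp only [dirLap, hessQF_invNormSqPow k hx, Finset.sum_sub_distrib, ← Finset.mul_sum,
    sum_inner_single_sq, hξ]
  have hx2 : ‖x‖ ^ 2 ≠ 0 := by simpa using hx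
  have h1 : ((‖x‖ ^ 2)⁻¹) ^ (k + 3) * ‖x‖ ^ 2 = ((‖x‖ ^ 2)⁻¹) ^ (k + 2) := by
    rw [pow_succ]; field_simp
  have h2 : 0 ≤ (p - 2) * (4 * (k + 1) * (k + 2) * ((‖x‖ ^ 2)⁻¹) ^ (k + 3) *
      (inner ℝ x ξ) ^ 2) := mul_nonneg (sub_nonneg.2 hp) (by positivity)
  simp only [PiLp.norm_single, norm_one, one_pow, Finset.sum_const, Finset.card_univ,
    Fintype.card_fin, nsmul_eq_mul, mul_one]
  have h3 : 4 * ((k : ℝ) + 1) * (k + 2) * ((‖x‖ ^ 2)⁻¹) ^ (k + 3) * ‖x‖ ^ 2 =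
      4 * (k + 1) * (k + 2) * ((‖x‖ ^ 2)⁻¹) ^ (k + 2) := by rw [mul_assoc, h1]
  rw [h3]
  nlinarith

lemma mveOp_translate (q ε : ℝ) (v : EucN N → ℝ) (ξ x h : EucN N) :
    mveOp q ε (fun y => v (y + h)) ξ x = mveOp q ε v ξ (x + h) := by
  have hb : (volume : Measure (EucN N)).real (ball x ε) =
      (volume : Measure (EucN N)).real (ball (x + h) ε) := by
    rw [Measure.addHaar_real_ball_center volume x ε,
      Measure.addHaar_real_ball_center volume (x + h) ε]
  simp only [mveOp, setAverage_eq, hb]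
  rw [integral_ball_translate x, integral_ball_translate (x + h)]
  simp only [add_right_comm x h, sub_add_eq_add_sub]

/-- Radial barrier: a strict discrete subsolution away from its pole, for all small radii. -/
lemma exists_barrier (hN : 2 ≤ N) {p q : ℝ} (hp : 2 ≤ p)
    (hq : q = ((N : ℝ) + 2) / ((N : ℝ) + p)) :
    ∃ k : ℕ, ∀ r R : ℝ, 0 < r → ∃ ε₀ > 0, ∀ x : EucN N, r ≤ ‖x‖ → ‖x‖ ≤ R →
      ∀ ε, 0 < ε → ε < ε₀ → IntegrableOn (fun y : EucN N => ((‖y‖ ^ 2)⁻¹) ^ (k + 1)) (ball x ε) ∧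
        ∀ ξ : EucN N, ‖ξ‖ = 1 → ((‖x‖ ^ 2)⁻¹) ^ (k + 1) ≤
          mveOp q ε (fun y : EucN N => ((‖y‖ ^ 2)⁻¹) ^ (k + 1)) ξ x := by
  obtain ⟨k, hk⟩ := exists_nat_ge ((N : ℝ) + p)
  refine ⟨k, fun r R hr => ?_⟩
  set g : EucN N → ℝ := fun y => ((‖y‖ ^ 2)⁻¹) ^ (k + 1) with hg
  set A : Set (EucN N) := closedBall 0 R \ ball 0 r with hA
  have hAc : IsCompact A := (isCompact_closedBall 0 R).diff isOpen_ball
  have key : ∃ ε₀ > 0, ∀ x ∈ A, ∀ ε, 0 < ε → ε < ε₀ → IntegrableOn g (ball x ε) ∧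
        ∀ ξ : EucN N, ‖ξ‖ = 1 → g x ≤ mveOp q ε g ξ x := by
    refine hAc.induction_on (p := fun S => ∃ ε₀ > 0, ∀ x ∈ S, ∀ ε, 0 < ε → ε < ε₀ →
      IntegrableOn g (ball x ε) ∧ ∀ ξ : EucN N, ‖ξ‖ = 1 → g x ≤ mveOp q ε g ξ x) ?_ ?_ ?_ ?_
    · exact ⟨1, one_pos, by simp⟩
    · rintro S T hST ⟨e, he, h⟩
      exact ⟨e, he, fun x hx => h x (hST hx)⟩
    · rintro S T ⟨e, he, h⟩ ⟨e', he', h'⟩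
      refine ⟨min e e', lt_min he he', fun x hx ε h0 hlt => ?_⟩
      rcases hx with hx | hx
      · exact h x hx ε h0 (hlt.trans_le (min_le_left _ _))
      · exact h' x hx ε h0 (hlt.trans_le (min_le_right _ _))
    · intro x hx
      have hx0 : x ≠ 0 := by
        rintro rfl
        exact hx.2 (mem_ball_self hr)
      have hgx : ContDiffAt ℝ 2 g x := contDiffAt_invNormSqPow _ hx0
      have hxp : 0 < ‖x‖ ^ 2 := by positivity
      set c : ℝ := 2 * (k + 1) * ((‖x‖ ^ 2)⁻¹) ^ (k + 2) * (2 * k + 6 - N - p) with hc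
      have hc0 : 0 < c := mul_pos (by positivity) (by
        have : (0 : ℝ) ≤ k := by positivity
        linarith)
      obtain ⟨ρ, hρ, h⟩ := exists_ball_mveOp_le hN hp hq
        (φ := fun y => (-1) * g y) (contDiffAt_const.mul hgx) hc0
      refine ⟨ball x ρ, mem_nhdsWithin_of_mem_nhds (ball_mem_nhds x hρ), ρ, hρ,
        fun y hy ε h0 hlt => ?_⟩
      obtain ⟨h1, h2⟩ := h y hy ε h0 hlt
      refine ⟨by simpa using h1.neg, fun ξ hξ => ?_⟩
      have h3 := h2 ξ hξ (by
        rw [dirLap_const_mul hgx]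
        have := dirLap_invNormSqPow hp k hx0 hξ
        linarith)
      rw [mveOp_const_mul] at h3
      linarith
  obtain ⟨ε₀, hε₀, h⟩ := key
  exact ⟨ε₀, hε₀, fun x h1 h2 => h x ⟨by simpa using h2, by simpa using h1⟩⟩

/-- One step of the boundary decay iteration. -/
lemma exists_boundary_decay (hN : 2 ≤ N) {p q : ℝ} (hp : 2 ≤ p)
    (hq : q = ((N : ℝ) + 2) / ((N : ℝ) + p)) {Ω : Set (EucN N)}
    (hΩb : Bornology.IsBounded Ω) {δbar μ : ℝ} (hμ : μ ∈ Ioo (0 : ℝ) 1)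
    (hΩlip : Corkscrew Ω δbar μ) {F : EucN N → ℝ} {K : ℝ≥0} (hΩo : IsOpen Ω)
    (hF : LipschitzOnWith K F Ωᶜ) {u : ℝ → EucN N → ℝ}
    (hu : ∀ ε : ℝ, 0 < ε → IsMVS q ε Ω F (u ε)) :
    ∃ θ : ℝ, 0 ≤ θ ∧ θ < 1 ∧ ∀ δ m ε₁ : ℝ, 0 < δ → δ < δbar → 0 ≤ m → 0 < ε₁ →
      (∀ ε, 0 < ε → ε < ε₁ → ∀ y ∈ frontier Ω, ∀ x ∈ closure Ω, dist x y < 5 * δ →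
        |u ε x - F y| ≤ m) →
      ∃ ε₂ > 0, ∀ ε, 0 < ε → ε < ε₂ → ∀ y ∈ frontier Ω, ∀ x ∈ closure Ω, dist x y < δ →
        |u ε x - F y| ≤ θ * m + 5 * K * δ := by
  obtain ⟨k, hk⟩ := exists_barrier hN hp hq
  obtain ⟨hμ0, hμ1⟩ := hμ
  set A1 : ℝ := (((μ / 2) ^ 2)⁻¹) ^ (k + 1) with hA1
  set A2 : ℝ := ((((2 : ℝ)) ^ 2)⁻¹) ^ (k + 1) with hA2
  set A3 : ℝ := ((((3 : ℝ)) ^ 2)⁻¹) ^ (k + 1) with hA3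
  have h23 : A3 < A2 := by
    rw [hA2, hA3]; gcongr; norm_num
  have h12 : A2 < A1 := by
    rw [hA1, hA2]; gcongr; linarith
  have h13 : 0 < A1 - A3 := by linarith
  refine ⟨(A1 - A2) / (A1 - A3), div_nonneg (by linarith) h13.le,
    (div_lt_one h13).2 (by linarith), ?_⟩
  intro δ m ε₁ hδ hδb hm0 hε₁ hyp
  obtain ⟨ε₀, hε₀, hbar⟩ := hk (μ * δ) (5 * δ) (by positivity)
  refine ⟨min (min ε₀ ε₁) (μ * δ / 2), by positivity, ?_⟩
  intro ε hε hlt y hy x hx hxy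
  have hε0 : ε < ε₀ := hlt.trans_le ((min_le_left _ _).trans (min_le_left _ _))
  have hε1 : ε < ε₁ := hlt.trans_le ((min_le_left _ _).trans (min_le_right _ _))
  have hε2 : ε < μ * δ / 2 := hlt.trans_le (min_le_right _ _)
  have hεδ : ε < δ := by nlinarith
  obtain ⟨z, hz⟩ := hΩlip δ hδ hδb y hy
  have hzy : dist z y < δ := (hz (mem_closedBall_self (by positivity))).1
  have hyΩ : y ∉ Ω := by
    rw [hΩo.frontier_eq] at hy; exact hy.2
  have hfar : ∀ w ∈ closure Ω, μ * δ ≤ dist w z := by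
    have hsub : closure Ω ⊆ (ball z (μ * δ))ᶜ := by
      refine closure_minimal ?_ isOpen_ball.isClosed_compl
      intro w hw hw'
      exact (hz (ball_subset_closedBall hw')).2 hw
    intro w hw
    simpa using hsub hw
  set g : EucN N → ℝ := fun y => ((‖y‖ ^ 2)⁻¹) ^ (k + 1) with hg
  set G : EucN N → ℝ := fun w => δ ^ (2 * (k + 1)) * g (w + -z) with hG
  have hGle : ∀ t : ℝ, 0 < t → ∀ w, t * δ ≤ dist w z → G w ≤ ((t ^ 2)⁻¹) ^ (k + 1) := by
    intro t ht w hw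
    have h1 : (t * δ) ^ 2 ≤ ‖w + -z‖ ^ 2 := by
      rw [← sub_eq_add_neg, ← dist_eq_norm]; gcongr
    have h2 : g (w + -z) ≤ (((t * δ) ^ 2)⁻¹) ^ (k + 1) := by
      simp only [hg]; gcongr
    calc G w ≤ δ ^ (2 * (k + 1)) * (((t * δ) ^ 2)⁻¹) ^ (k + 1) := by
          simp only [hG]; gcongr
      _ = ((t ^ 2)⁻¹) ^ (k + 1) := by
          rw [pow_mul, ← mul_pow]; congr 1; field_simp
  have hGge : ∀ t : ℝ, 0 < t → ∀ w, dist w z ≤ t * δ → 0 < dist w z →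
      ((t ^ 2)⁻¹) ^ (k + 1) ≤ G w := by
    intro t ht w hw hw0
    have h1 : ‖w + -z‖ ^ 2 ≤ (t * δ) ^ 2 := by
      rw [← sub_eq_add_neg, ← dist_eq_norm]; gcongr
    have h0 : 0 < ‖w + -z‖ ^ 2 := by
      rw [← sub_eq_add_neg, ← dist_eq_norm]; positivity
    have h2 : (((t * δ) ^ 2)⁻¹) ^ (k + 1) ≤ g (w + -z) := by
      simp only [hg]; gcongr
    calc ((t ^ 2)⁻¹) ^ (k + 1) = δ ^ (2 * (k + 1)) * (((t * δ) ^ 2)⁻¹) ^ (k + 1) := by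
          rw [pow_mul, ← mul_pow]; congr 1; field_simp
      _ ≤ G w := by simp only [hG]; gcongr
  set c : ℝ := m / (A1 - A3) with hc
  have hc0 : 0 ≤ c := div_nonneg hm0 h13.le
  have hcm : c * (A1 - A3) = m := by rw [hc]; field_simp
  set Ψ : EucN N → ℝ := fun w => (-c) * G w + (5 * K * δ + c * A1) with hΨ
  set D : Set (EucN N) := closure Ω ∩ ball y (4 * δ) with hD
  have hDsub : D ⊆ closure Ω := inter_subset_left
  have hball : ∀ w ∈ D, μ * δ ≤ ‖w + -z‖ ∧ ‖w + -z‖ ≤ 5 * δ := by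
    intro w hw
    rw [← sub_eq_add_neg, ← dist_eq_norm]
    refine ⟨hfar w hw.1, ?_⟩
    have h1 := dist_triangle w y z
    have h2 : dist w y < 4 * δ := hw.2
    rw [dist_comm y z] at h1
    linarith
  have hGint : ∀ w ∈ D, IntegrableOn G (ball w ε) := by
    intro w hw
    obtain ⟨h1, h2⟩ := hball w hw
    have h3 := (hbar _ h1 h2 ε hε hε0).1
    have h4 := (measurePreserving_add_right (volume : Measure (EucN N))
      (-z)).integrableOn_comp_preimage (measurableEmbedding_addRight (-z)) (f := g)
      (s := ball (w + -z) ε)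
    have h5 : (fun y => y + -z) ⁻¹' ball (w + -z) ε = ball w ε := by
      ext y; simp
    rw [h5] at h4
    exact (h4.2 h3).const_mul _
  have hGm : ∀ w ∈ D, ∀ ξ : EucN N, ‖ξ‖ = 1 → G w ≤ mveOp q ε G ξ w := by
    intro w hw ξ hξ
    obtain ⟨h1, h2⟩ := hball w hw
    have h3 := (hbar _ h1 h2 ε hε hε0).2 ξ hξ
    simp only [hG]
    rw [mveOp_const_mul, mveOp_translate]
    gcongr
  have hΨint : ∀ w ∈ D, IntegrableOn Ψ (ball w ε) := fun w hw =>
    ((hGint w hw).const_mul (-c)).add (integrableOn_const measure_ball_lt_top.ne)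
  have hΨm : ∀ w ∈ D, ∀ ξ : EucN N, ‖ξ‖ = 1 → mveOp q ε Ψ ξ w ≤ Ψ w := by
    intro w hw ξ hξ
    have h1 := mul_le_mul_of_nonneg_left (hGm w hw ξ hξ) hc0
    simp only [hΨ]
    rw [mveOp_add ((hGint w hw).const_mul (-c)) (integrableOn_const measure_ball_lt_top.ne),
      mveOp_const_mul, mveOp_const hε]
    linarith
  have hΨ0 : ∀ w, μ / 2 * δ ≤ dist w z → 5 * K * δ ≤ Ψ w := by
    intro w hw
    have h1 := mul_le_mul_of_nonneg_left (hGle (μ / 2) (by positivity) w hw) hc0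
    simp only [hΨ]
    linarith
  have hΨ3 : ∀ w, 3 * δ ≤ dist w z → 5 * K * δ + m ≤ Ψ w := by
    intro w hw
    have h1 := mul_le_mul_of_nonneg_left (hGle 3 (by positivity) w hw) hc0
    rw [← hA3] at h1
    simp only [hΨ]
    linarith
  have hΨ2 : Ψ x ≤ (A1 - A2) / (A1 - A3) * m + 5 * K * δ := by
    have h0 := hfar x hx
    have h1 : dist x z ≤ 2 * δ := by
      have h1 := dist_triangle x y z
      rw [dist_comm y z] at h1
      linarith
    have h2 := mul_le_mul_of_nonneg_left (hGge 2 (by positivity) x h1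
      (lt_of_lt_of_le (by positivity) h0)) hc0
    have h3 : (A1 - A2) / (A1 - A3) * m = c * (A1 - A2) := by rw [hc]; field_simp
    rw [h3]
    rw [← hA2] at h2
    simp only [hΨ]
    linarith
  have hout : ∀ w ∈ D, ∀ w' ∈ closedBall w ε, w' ∉ D → |u ε w' - F y| ≤ Ψ w' := by
    intro w hw w' hw' hnot
    have hww : dist w' w ≤ ε := hw'
    have hwz := hfar w hw.1
    have hwy : dist w y < 4 * δ := hw.2
    have h1 : dist w' y ≤ 5 * δ - (δ - ε) + 0 ∧ dist w' y < 5 * δ := by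
      have := dist_triangle w' w y
      constructor <;> linarith
    have h2 : μ / 2 * δ ≤ dist w' z := by
      have := dist_triangle w w' z
      rw [dist_comm w w'] at this
      linarith
    by_cases hcl : w' ∈ closure Ω
    · have h3 : 4 * δ ≤ dist w' y := by
        by_contra h; exact hnot ⟨hcl, not_le.1 h⟩
      have h4 : 3 * δ ≤ dist w' z := by
        have := dist_triangle w' z y
        linarith
      have h5 := hyp ε hε hε1 y hy w' hcl h1.2
      have h6 := hΨ3 w' h4
      have : (0 : ℝ) ≤ 5 * K * δ := by positivity
      linarith
    · rw [(hu ε hε).eq_boundary hw.1 hw' hcl, ← Real.dist_eq]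
      refine (hF.dist_le_mul w' (fun h => hcl (subset_closure h)) y hyΩ).trans ?_
      refine le_trans ?_ (hΨ0 w' h2)
      have := mul_le_mul_of_nonneg_left h1.2.le K.2
      have h7 : (K : ℝ) * dist w' y ≤ K * (5 * δ) := this
      linarith
  have hxD : x ∈ D := ⟨hx, by rw [mem_ball]; linarith⟩
  have hDz : ∀ w ∈ D, μ / 2 * δ ≤ dist w z := by
    intro w hw
    have := hfar w hw.1
    have : 0 < μ * δ := by positivity
    linarith
  obtain ⟨ξ₀, hξ₀⟩ := exists_norm_eq_one hN
  have hup := (hu ε hε).sub_le hN hp hq hε hΩb hDsub (m := F y)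
    (fun w hw => hΨ0 w (hDz w hw)) hΨint hΨm
    (fun w hw w' hw' hnot => by
      have := (abs_le'.1 (hout w hw w' hw' hnot)).1
      linarith) x hxD
  have hlow := (hu ε hε).le_sub hN hp hq hε hΩb hDsub (Ψ := fun w => (-1) * Ψ w)
    (B := -(5 * K * δ)) (m := -F y)
    (fun w hw => by
      have := hΨ0 w (hDz w hw)
      linarith) (fun w hw => (hΨint w hw).const_mul (-1))
    (fun w hw => ⟨ξ₀, hξ₀, by
      rw [mveOp_const_mul]
      have := hΨm w hw ξ₀ hξ₀
      linarith⟩)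
    (fun w hw w' hw' hnot => by
      have := (abs_le'.1 (hout w hw w' hw' hnot)).2
      linarith) x hxD
  rw [abs_le]
  constructor <;> linarith

/-- The mean value solutions attain the boundary data uniformly. -/
lemma boundary_estimate (hN : 2 ≤ N) {p q : ℝ} (hp : 2 ≤ p)
    (hq : q = ((N : ℝ) + 2) / ((N : ℝ) + p)) {Ω : Set (EucN N)} (hΩo : IsOpen Ω)
    (hΩb : Bornology.IsBounded Ω) {δbar μ : ℝ} (hδbar : 0 < δbar) (hμ : μ ∈ Ioo (0 : ℝ) 1)
    (hΩlip : Corkscrew Ω δbar μ) {F : EucN N → ℝ} {K : ℝ≥0}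
    (hF : LipschitzOnWith K F Ωᶜ) {u : ℝ → EucN N → ℝ}
    (hu : ∀ ε : ℝ, 0 < ε → IsMVS q ε Ω F (u ε)) {η : ℝ} (hη : 0 < η) :
    ∃ δ > 0, ∀ ε, 0 < ε → ε < δ → ∀ y ∈ frontier Ω, ∀ x ∈ closure Ω, dist x y < δ →
      |u ε x - F y| ≤ η := by
  obtain ⟨θ, hθ0, hθ1, hstep⟩ := exists_boundary_decay hN hp hq hΩb hμ hΩlip hΩo hF hu
  set S : Set ℝ := {m | 0 ≤ m ∧ ∃ δ > 0, ∀ ε, 0 < ε → ε < δ → ∀ y ∈ frontier Ω,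
    ∀ x ∈ closure Ω, dist x y < δ → |u ε x - F y| ≤ m} with hS
  by_cases hne : (frontier Ω).Nonempty
  swap
  · exact ⟨1, one_pos, fun ε _ _ y hy => absurd ⟨y, hy⟩ hne⟩
  have hcompl : frontier Ω ⊆ Ωᶜ := by
    rw [hΩo.frontier_eq]; exact fun y hy => hy.2
  have hSne : S.Nonempty := by
    obtain ⟨y₀, hy₀⟩ := hne
    obtain ⟨A, hA0, hA⟩ := exists_uniform_bound hN hp hq hΩb hF ⟨y₀, hcompl hy₀⟩ hu
    obtain ⟨R, hR0, hR⟩ := hΩb.closure.exists_pos_norm_le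
    refine ⟨A + K + (|F y₀| + K * (2 * R)), by positivity, 1, one_pos,
      fun ε h0 h1 y hy x hx _ => ?_⟩
    have h2 := hA ε h0 x hx
    have h3 := hF.dist_le_mul y (hcompl hy) y₀ (hcompl hy₀)
    have h4 : dist y y₀ ≤ 2 * R := by
      rw [dist_eq_norm]
      have := norm_sub_le y y₀
      have := hR y (frontier_subset_closure hy)
      have := hR y₀ (frontier_subset_closure hy₀)
      linarith
    have h5 : (K : ℝ) * dist y y₀ ≤ K * (2 * R) := by gcongr
    have h6 : (K : ℝ) * ε ≤ K := by
      have := mul_le_mul_of_nonneg_left h1.le K.2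
      simpa using this
    rw [Real.dist_eq] at h3
    have h7 := abs_sub_abs_le_abs_sub (F y) (F y₀)
    have h8 := abs_sub (u ε x) (F y)
    linarith
  have hSb : BddBelow S := ⟨0, fun m hm => hm.1⟩
  have hSup : ∀ m ∈ S, ∀ m', m ≤ m' → m' ∈ S := by
    rintro m ⟨h0, δ, hδ, h⟩ m' hmm
    exact ⟨h0.trans hmm, δ, hδ, fun ε h1 h2 y hy x hx hd => (h ε h1 h2 y hy x hx hd).trans hmm⟩
  have hSs : ∀ m ∈ S, ∀ κ > 0, θ * m + κ ∈ S := by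
    rintro m ⟨hm0, δ₁, hδ₁, h⟩ κ hκ
    set δ := min (min (δ₁ / 5) (δbar / 2)) (κ / (5 * K + 1)) with hδ
    have hδ0 : 0 < δ := by positivity
    have hδ1 : δ ≤ δ₁ / 5 := (min_le_left _ _).trans (min_le_left _ _)
    have hδ2 : δ ≤ δbar / 2 := (min_le_left _ _).trans (min_le_right _ _)
    have hδ3 : δ * (5 * K + 1) ≤ κ := by
      rw [← le_div_iff₀ (by positivity)]; exact min_le_right _ _
    obtain ⟨ε₂, hε₂, h2⟩ := hstep δ m δ₁ hδ0 (by linarith) hm0 hδ₁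
      (fun ε h0 h1 y hy x hx hd => h ε h0 h1 y hy x hx (by linarith))
    refine ⟨by positivity, min δ ε₂, by positivity, fun ε h0 h1 y hy x hx hd => ?_⟩
    refine (h2 ε h0 (h1.trans_le (min_le_right _ _)) y hy x hx
      (hd.trans_le (min_le_left _ _))).trans ?_
    linarith
  have hinf : sInf S ≤ 0 := by
    have hle : ∀ m ∈ S, ∀ κ > 0, sInf S ≤ θ * m + κ := fun m hm κ hκ =>
      csInf_le hSb (hSs m hm κ hκ)
    by_contra! hpos
    set κ := (1 - θ) * sInf S / 4 with hκ
    have hκ0 : 0 < κ := by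
      have : 0 < 1 - θ := by linarith
      positivity
    obtain ⟨m, hm, hmlt⟩ := exists_lt_of_csInf_lt hSne (lt_add_of_pos_right (sInf S) hκ0)
    have h1 := hle m hm κ hκ0
    have h2 : θ * m ≤ θ * (sInf S + κ) := by gcongr
    have h3 : θ * κ ≤ κ := by nlinarith
    nlinarith
  obtain ⟨m, hm, hmlt⟩ := exists_lt_of_csInf_lt hSne (hinf.trans_lt hη)
  exact (hSup m hm η hmlt.le).2

lemma exists_mem_frontier_segment {Ω : Set (EucN N)} (hΩo : IsOpen Ω) {x y : EucN N}
    (hx : x ∈ closure Ω) (hy : y ∉ Ω) :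
    ∃ w ∈ frontier Ω, dist x w ≤ dist x y ∧ dist w y ≤ dist x y := by
  by_cases hxΩ : x ∈ Ω
  · obtain ⟨w, hw, hwf⟩ : (segment ℝ x y ∩ frontier Ω).Nonempty := by
      by_contra hemp
      rw [not_nonempty_iff_eq_empty] at hemp
      have hnot : ∀ w ∈ segment ℝ x y, w ∉ Ω → w ∈ (closure Ω)ᶜ := fun w hw hwΩ hwc => by
        have : w ∈ segment ℝ x y ∩ frontier Ω := ⟨hw, by rw [hΩo.frontier_eq]; exact ⟨hwc, hwΩ⟩⟩
        rwa [hemp] at this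
      obtain ⟨w, -, hw1, hw2⟩ := (convex_segment (𝕜 := ℝ) x y).isPreconnected Ω (closure Ω)ᶜ
        hΩo isClosed_closure.isOpen_compl
        (fun w hw => (em (w ∈ Ω)).imp id (hnot w hw)) ⟨x, left_mem_segment ℝ x y, hxΩ⟩
        ⟨y, right_mem_segment ℝ x y, hnot y (right_mem_segment ℝ x y) hy⟩
      exact hw2 (subset_closure hw1)
    have h := dist_add_dist_of_mem_segment hw
    exact ⟨w, hwf, by linarith [dist_nonneg (x := w) (y := y)],
      by linarith [dist_nonneg (x := x) (y := w)]⟩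
  · exact ⟨x, by rw [hΩo.frontier_eq]; exact ⟨hx, hxΩ⟩, by simp, le_rfl⟩

lemma exterior_estimate (hN : 2 ≤ N) {p q : ℝ} (hp : 2 ≤ p)
    (hq : q = ((N : ℝ) + 2) / ((N : ℝ) + p)) {Ω : Set (EucN N)} (hΩo : IsOpen Ω)
    (hΩb : Bornology.IsBounded Ω) {δbar μ : ℝ} (hδbar : 0 < δbar) (hμ : μ ∈ Ioo (0 : ℝ) 1)
    (hΩlip : Corkscrew Ω δbar μ) {F : EucN N → ℝ} {K : ℝ≥0}
    (hF : LipschitzOnWith K F Ωᶜ) {u : ℝ → EucN N → ℝ}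
    (hu : ∀ ε : ℝ, 0 < ε → IsMVS q ε Ω F (u ε)) {η : ℝ} (hη : 0 < η) :
    ∃ δ > 0, K * δ ≤ η ∧ ∀ ε, 0 < ε → ε < δ → ∀ y ∉ Ω, ∀ x ∈ closure Ω, dist x y < δ →
      |u ε x - F y| ≤ η := by
  obtain ⟨δ₁, hδ₁, h⟩ := boundary_estimate hN hp hq hΩo hΩb hδbar hμ hΩlip hF hu (half_pos hη)
  have hδ3 : min δ₁ (η / 2 / (K + 1)) * (K + 1) ≤ η / 2 := by
    rw [← le_div_iff₀ (by positivity)]; exact min_le_right _ _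
  have hpos : 0 < min δ₁ (η / 2 / (K + 1)) := by positivity
  refine ⟨min δ₁ (η / 2 / (K + 1)), hpos, by linarith, fun ε h0 h1 y hy x hx hd => ?_⟩
  obtain ⟨w, hw, hxw, hwy⟩ := exists_mem_frontier_segment hΩo hx hy
  have h2 := h ε h0 (h1.trans_le (min_le_left _ _)) w hw x hx
    (hxw.trans_lt (hd.trans_le (min_le_left _ _)))
  have hwc : w ∈ Ωᶜ := by
    rw [hΩo.frontier_eq] at hw; exact hw.2
  have h3 := hF.dist_le_mul w hwc y hy
  have h4 : (K : ℝ) * dist w y ≤ K * min δ₁ (η / 2 / (K + 1)) := by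
    gcongr; exact hwy.trans hd.le
  rw [Real.dist_eq] at h3
  have h5 := abs_sub_le (u ε x) (F w) (F y)
  linarith

/-- Asymptotic equicontinuity of the mean value solutions. -/
lemma asymptotic_equicontinuity (hN : 2 ≤ N) {p q : ℝ} (hp : 2 ≤ p)
    (hq : q = ((N : ℝ) + 2) / ((N : ℝ) + p)) {Ω : Set (EucN N)} (hΩo : IsOpen Ω)
    (hΩb : Bornology.IsBounded Ω) {δbar μ : ℝ} (hδbar : 0 < δbar) (hμ : μ ∈ Ioo (0 : ℝ) 1)
    (hΩlip : Corkscrew Ω δbar μ) {F : EucN N → ℝ} {K : ℝ≥0}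
    (hF : LipschitzOnWith K F Ωᶜ) {u : ℝ → EucN N → ℝ}
    (hu : ∀ ε : ℝ, 0 < ε → IsMVS q ε Ω F (u ε)) {η : ℝ} (hη : 0 < η) :
    ∃ δ > 0, ∀ ε, 0 < ε → ε < δ → ∀ x ∈ closure Ω, ∀ y ∈ closure Ω, dist x y < δ →
      u ε x - u ε y ≤ η := by
  obtain ⟨δ, hδ, hKδ, h⟩ := exterior_estimate hN hp hq hΩo hΩb hδbar hμ hΩlip hF hu hη
  refine ⟨δ, hδ, fun ε h0 h1 x' hx' y hy hd => ?_⟩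
  obtain ⟨t, rfl⟩ : ∃ t, x' = y + t := ⟨x' - y, by abel⟩
  have ht : ‖t‖ < δ := by simpa using hd
  have hue := hu ε h0
  obtain ⟨C, hC⟩ := hue.abs_le_closure h0
  have hint : ∀ x, x + t ∈ closure Ω → IntegrableOn (fun w => u ε (w + t)) (ball x ε) := by
    intro x hx
    have h4 := (measurePreserving_add_right (volume : Measure (EucN N))
      t).integrableOn_comp_preimage (measurableEmbedding_addRight t) (f := u ε)
      (s := ball (x + t) ε)
    have h5 : (fun y => y + t) ⁻¹' ball (x + t) ε = ball x ε := by
      ext y; simp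
    rw [h5] at h4
    exact h4.2 (hue.integrableOn_ball hx)
  refine discrete_comparison hN hp hq (D := {x | x ∈ closure Ω ∧ x + t ∈ closure Ω})
    (hΩb.closure.subset fun x hx => hx.1) h0 (z := fun x => u ε (x + t) - u ε x) (m := η)
    ?_ (fun x hx => (hint x hx.2).sub (hue.integrableOn_ball hx.1)) ?_ ?_ y ⟨hy, hx'⟩
  · refine ⟨C + C, ?_⟩
    rintro _ ⟨x, hx, rfl⟩
    have := (abs_le.1 (hC _ hx.1)).1
    have := (abs_le.1 (hC _ hx.2)).2
    change u ε (x + t) - u ε x ≤ C + C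
    linarith
  · intro x hx κ hκ
    obtain ⟨ξ, hξ, h2⟩ := hue.exists_le hN hx.2 hκ
    refine ⟨ξ, hξ, ?_⟩
    rw [mveOp_sub (hint x hx.2) (hue.integrableOn_ball hx.1), mveOp_translate]
    have := hue.mveOp_le (weight_nonneg_le_one hp hq) h0 hx.1 hξ
    change u ε (x + t) - u ε x ≤ _
    linarith
  · intro x hx w hw hnot
    have hwt : w + t ∈ closedBall (x + t) ε := by simpa using hw
    have hdw : dist (w + t) w < δ := by simpa using ht
    by_cases hw1 : w ∈ closure Ω
    · have hw2 : w + t ∉ closure Ω := fun hh => hnot ⟨hw1, hh⟩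
      rw [hue.eq_boundary hx.2 hwt hw2]
      have := h ε h0 h1 (w + t) (fun hh => hw2 (subset_closure hh)) w hw1 (by rwa [dist_comm])
      have := (abs_le.1 this).1
      linarith
    · rw [hue.eq_boundary hx.1 hw hw1]
      by_cases hw2 : w + t ∈ closure Ω
      · exact (abs_le.1 (h ε h0 h1 w (fun hh => hw1 (subset_closure hh)) (w + t) hw2 hdw)).2
      · rw [hue.eq_boundary hx.2 hwt hw2]
        have h3 := hF.dist_le_mul (w + t) (fun hh => hw2 (subset_closure hh)) w
          (fun hh => hw1 (subset_closure hh))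
        have h4 : (K : ℝ) * dist (w + t) w ≤ K * δ := by gcongr
        rw [Real.dist_eq] at h3
        have := le_abs_self (F (w + t) - F w)
        linarith

/-- The family `u` is bounded, uniformly for bounded `ε`, on `closure Ω`. -/
def LocBdd (Ω : Set (EucN N)) (u : ℝ → EucN N → ℝ) : Prop :=
  ∃ A B : ℝ, ∀ ε, 0 < ε → ∀ x ∈ closure Ω, |u ε x| ≤ A + B * ε

lemma LocBdd.neg {Ω : Set (EucN N)} {u : ℝ → EucN N → ℝ} (hb : LocBdd Ω u) :
    LocBdd Ω (fun ε x => -u ε x) := by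
  obtain ⟨A, B, h⟩ := hb
  exact ⟨A, B, fun ε hε x hx => by rw [abs_neg]; exact h ε hε x hx⟩

lemma LocBdd.bddAbove {Ω : Set (EucN N)} {u : ℝ → EucN N → ℝ} (hb : LocBdd Ω u) (x : EucN N)
    (δ : ℝ) : BddAbove {r | ∃ ε y, 0 < ε ∧ ε < δ ∧ y ∈ closure Ω ∧ dist y x ≤ δ ∧ r = u ε y} := by
  obtain ⟨A, B, h⟩ := hb
  refine ⟨A + |B| * δ, ?_⟩
  rintro _ ⟨ε, y, h0, h1, hy, -, rfl⟩
  have h2 := (abs_le.1 (h ε h0 y hy)).2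
  have h3 : B * ε ≤ |B| * δ :=
    (mul_le_mul_of_nonneg_right (le_abs_self B) h0.le).trans (by gcongr)
  linarith

lemma eventually_lt_of_ubarF_lt {Ω : Set (EucN N)} {u : ℝ → EucN N → ℝ} (hb : LocBdd Ω u)
    {x : EucN N} {a : ℝ} (h : ubarF Ω u x < a) :
    ∃ δ > 0, ∀ ε, 0 < ε → ε < δ → ∀ y ∈ closure Ω, dist y x ≤ δ → u ε y < a := by
  have : Nonempty (Ioi (0 : ℝ)) := ⟨⟨1, mem_Ioi.2 one_pos⟩⟩
  obtain ⟨δ, hδ⟩ := exists_lt_of_ciInf_lt h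
  exact ⟨δ, δ.2, fun ε h0 h1 y hy hd =>
    (le_csSup (hb.bddAbove x δ) ⟨ε, y, h0, h1, hy, hd, rfl⟩).trans_lt hδ⟩

lemma ubarF_le {Ω : Set (EucN N)} {u : ℝ → EucN N → ℝ} (hb : LocBdd Ω u)
    {x : EucN N} (hx : x ∈ closure Ω) {a δ : ℝ} (hδ : 0 < δ)
    (h : ∀ ε, 0 < ε → ε < δ → ∀ y ∈ closure Ω, dist y x ≤ δ → u ε y ≤ a) :
    ubarF Ω u x ≤ a := by
  have hbelow : BddBelow (range fun δ : Ioi (0 : ℝ) =>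
      sSup {r | ∃ ε y, 0 < ε ∧ ε < (δ : ℝ) ∧ y ∈ closure Ω ∧ dist y x ≤ (δ : ℝ) ∧
        r = u ε y}) := by
    obtain ⟨A, B, hAB⟩ := hb
    refine ⟨-(A + |B|), ?_⟩
    rintro _ ⟨δ, rfl⟩
    have hδ0 : (0 : ℝ) < δ := δ.2
    have hε : 0 < min ((δ : ℝ) / 2) 1 := by positivity
    have h1 : u (min ((δ : ℝ) / 2) 1) x ≤ sSup {r | ∃ ε y, 0 < ε ∧ ε < (δ : ℝ) ∧
        y ∈ closure Ω ∧ dist y x ≤ (δ : ℝ) ∧ r = u ε y} :=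
      le_csSup (LocBdd.bddAbove ⟨A, B, hAB⟩ x δ) ⟨_, x, hε,
        (min_le_left _ _).trans_lt (by linarith), hx, by simpa using hδ0.le, rfl⟩
    have h2 := (abs_le.1 (hAB _ hε x hx)).1
    have h3 : B * min ((δ : ℝ) / 2) 1 ≤ |B| * 1 :=
      (mul_le_mul_of_nonneg_right (le_abs_self B) hε.le).trans (by gcongr; exact min_le_right _ _)
    dsimp only
    linarith
  refine (ciInf_le hbelow ⟨δ, hδ⟩).trans (csSup_le ?_ ?_)
  · exact ⟨_, δ / 2, x, by positivity, by simpa using hδ, hx, by simpa using hδ.le, rfl⟩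
  · rintro _ ⟨ε, y, h0, h1, hy, hd, rfl⟩
    exact h ε h0 h1 y hy hd

lemma ulowF_eq_neg_ubarF (Ω : Set (EucN N)) (u : ℝ → EucN N → ℝ) (x : EucN N) :
    ulowF Ω u x = -ubarF Ω (fun ε y => -u ε y) x := by
  rw [ubarF, ulowF, iInf, Real.sInf_def, neg_neg, iSup]
  congr 1
  ext r
  simp only [mem_range, Set.mem_neg, Real.sInf_def]
  refine exists_congr fun δ => ?_
  rw [neg_eq_iff_eq_neg]
  have : ∀ S : Set ℝ, ∀ S', -S = S' → (sSup (-S) = -r ↔ sSup S' = -r) := by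
    rintro S _ rfl; rfl
  refine this _ _ ?_
  ext s
  simp only [Set.mem_neg, mem_ofPred_eq]
  refine exists_congr fun ε => exists_congr fun y => ?_
  rw [neg_eq_iff_eq_neg]

lemma ulowF_le_ubarF {Ω : Set (EucN N)} {u : ℝ → EucN N → ℝ} (hb : LocBdd Ω u)
    {x : EucN N} (hx : x ∈ closure Ω) : ulowF Ω u x ≤ ubarF Ω u x := by
  rw [ulowF_eq_neg_ubarF]
  by_contra! h
  obtain ⟨a, ha1, ha2⟩ := exists_between h
  obtain ⟨δ₁, hδ₁, h1⟩ := eventually_lt_of_ubarF_lt hb ha1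
  obtain ⟨δ₂, hδ₂, h2⟩ := eventually_lt_of_ubarF_lt hb.neg (lt_neg.1 ha2)
  have hm : 0 < min δ₁ δ₂ := lt_min hδ₁ hδ₂
  have h3 := h1 (min δ₁ δ₂ / 2) (by positivity)
    (by linarith [min_le_left δ₁ δ₂]) x hx (by simpa using hδ₁.le)
  have h4 := h2 (min δ₁ δ₂ / 2) (by positivity)
    (by linarith [min_le_right δ₁ δ₂]) x hx (by simpa using hδ₂.le)
  linarith

lemma continuousOn_ubarF {Ω : Set (EucN N)} {u : ℝ → EucN N → ℝ} (hb : LocBdd Ω u)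
    (heq : ∀ η > 0, ∃ δ > 0, ∀ ε, 0 < ε → ε < δ → ∀ x ∈ closure Ω, ∀ y ∈ closure Ω,
      dist x y < δ → u ε x - u ε y ≤ η) : ContinuousOn (ubarF Ω u) (closure Ω) := by
  rw [Metric.continuousOn_iff]
  intro x hx η hη
  obtain ⟨δ, hδ, h⟩ := heq (η / 3) (by positivity)
  have key : ∀ y ∈ closure Ω, ∀ z ∈ closure Ω, dist y z < δ / 2 →
      ubarF Ω u y ≤ ubarF Ω u z + 2 * (η / 3) := by
    intro y hy z hz hd
    obtain ⟨δ₁, hδ₁, h1⟩ := eventually_lt_of_ubarF_lt hb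
      (lt_add_of_pos_right (ubarF Ω u z) (by positivity : 0 < η / 3))
    refine ubarF_le hb hy (δ := min (δ / 2) δ₁) (by positivity) fun ε h0 hε w hw hwd => ?_
    have h2 := h1 ε h0 (hε.trans_le (min_le_right _ _)) z hz (by simpa using hδ₁.le)
    have h3 := h ε h0 (hε.trans_le ((min_le_left _ _).trans (by linarith))) w hw z hz (by
      have := dist_triangle w y z
      have := hwd.trans (min_le_left _ _)
      linarith)
    linarith
  refine ⟨δ / 2, by positivity, fun y hy hd => ?_⟩
  rw [Real.dist_eq, abs_lt]
  have h1 := key y hy x hx hd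
  have h2 := key x hx y hy (by rwa [dist_comm])
  constructor <;> linarith

lemma ubarF_eq_of_boundary {Ω : Set (EucN N)} {u : ℝ → EucN N → ℝ} {F : EucN N → ℝ}
    (hb : LocBdd Ω u) {y : EucN N} (hy : y ∈ closure Ω)
    (hbd : ∀ η > 0, ∃ δ > 0, ∀ ε, 0 < ε → ε < δ → ∀ x ∈ closure Ω, dist x y < δ →
      |u ε x - F y| ≤ η) : ubarF Ω u y = F y := by
  refine le_antisymm (le_of_forall_pos_le_add fun η hη => ?_)
    (le_of_forall_pos_le_add fun η hη => ?_)
  · obtain ⟨δ, hδ, h⟩ := hbd η hη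
    refine ubarF_le hb hy (half_pos hδ) fun ε h0 h1 x hx hd => ?_
    have := (abs_le.1 (h ε h0 (by linarith) x hx (by linarith))).2
    linarith
  · obtain ⟨δ, hδ, h⟩ := hbd (η / 2) (half_pos hη)
    obtain ⟨δ₁, hδ₁, h1⟩ := eventually_lt_of_ubarF_lt hb
      (lt_add_of_pos_right (ubarF Ω u y) (half_pos hη))
    have hm : 0 < min δ δ₁ := lt_min hδ hδ₁
    have h2 := h1 (min δ δ₁ / 2) (by positivity) (by linarith [min_le_right δ δ₁]) y hy
      (by simpa using hδ₁.le)
    have h3 := (abs_le.1 (h (min δ δ₁ / 2) (by positivity) (by linarith [min_le_left δ δ₁]) y hy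
      (by simpa using hδ))).1
    linarith

/-- A continuous strict majorant of the upper half-relaxed limit on a compact set is a majorant
of `u ε` for all small `ε`. -/
lemma eventually_le_of_ubarF_lt {Ω : Set (EucN N)} {u : ℝ → EucN N → ℝ} (hb : LocBdd Ω u)
    {S : Set (EucN N)} (hS : IsCompact S) (hSΩ : S ⊆ closure Ω) {ψ : EucN N → ℝ}
    (hψ : ContinuousOn ψ S) (hlt : ∀ y ∈ S, ubarF Ω u y < ψ y) :
    ∃ δ > 0, ∀ ε, 0 < ε → ε < δ → ∀ y ∈ S, u ε y ≤ ψ y := by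
  have h : ∀ᶠ ε in 𝓝 (0 : ℝ), ∀ y ∈ S, 0 < ε → y ∈ S → u ε y ≤ ψ y := by
    refine hS.eventually_forall_of_forall_eventually fun y hy => ?_
    obtain ⟨a, ha1, ha2⟩ := exists_between (hlt y hy)
    obtain ⟨δ, hδ, h1⟩ := eventually_lt_of_ubarF_lt hb ha1
    have h2 := hψ y hy (lt_mem_nhds ha2)
    rw [mem_map, mem_nhdsWithin_iff_exists_mem_nhds_inter] at h2
    obtain ⟨V, hV, hVS⟩ := h2
    filter_upwards [prod_mem_nhds (Iio_mem_nhds hδ)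
      (inter_mem hV (closedBall_mem_nhds y hδ))] with ⟨ε, z⟩ hz h0 hzS
    have h3 := h1 ε h0 hz.1 z (hSΩ hzS) hz.2.2
    have h4 : a < ψ z := hVS ⟨hz.2.1, hzS⟩
    exact (h3.trans h4).le
  obtain ⟨δ, hδ, h1⟩ := Metric.eventually_nhds_iff.1 h
  refine ⟨δ, hδ, fun ε h0 hε y hy => h1 ?_ y hy h0 hy⟩
  rwa [Real.dist_eq, sub_zero, abs_of_pos h0]

/-- A strict test function at `x₀` cannot satisfy a discrete comparison principle
near `x₀`. -/
lemma not_strict_touching_of_comparison {Ω : Set (EucN N)} (hΩo : IsOpen Ω)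
    {u : ℝ → EucN N → ℝ} (hb : LocBdd Ω u) (hcont : ContinuousOn (ubarF Ω u) (closure Ω))
    {φ : EucN N → ℝ} (hφ : ContinuousOn φ Ω) {x₀ : EucN N} (hx₀ : x₀ ∈ Ω)
    (heq : φ x₀ = ubarF Ω u x₀) (hlt : ∀ x ∈ Ω, x ≠ x₀ → ubarF Ω u x < φ x)
    {r : ℝ} (hr : 0 < r)
    (hcomp : ∀ ρ, 0 < ρ → ρ < r → closedBall x₀ ρ ⊆ Ω → ∀ ε, 0 < ε → ε < r → ∀ m,
      (∀ x ∈ closedBall x₀ ρ, ∀ y ∈ closedBall x ε, y ∉ closedBall x₀ ρ → u ε y - φ y ≤ m) →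
      ∀ x ∈ closedBall x₀ ρ, u ε x - φ x ≤ m) : False := by
  obtain ⟨r₀, hr₀, hball⟩ := Metric.isOpen_iff.1 hΩo x₀ hx₀
  set ρ := min (r / 2) (r₀ / 4) with hρ
  have hρ0 : 0 < ρ := by positivity
  have hρ1 : ρ < r := (min_le_left _ _).trans_lt (by linarith)
  have hρ2 : 2 * ρ < r₀ := by linarith [min_le_right (r / 2) (r₀ / 4)]
  have hbig : closedBall x₀ (2 * ρ) ⊆ Ω := (closedBall_subset_ball hρ2).trans hball
  have hsmall : closedBall x₀ ρ ⊆ Ω := (closedBall_subset_closedBall (by linarith)).trans hbig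
  set S := closedBall x₀ (2 * ρ) \ ball x₀ ρ with hSdef
  have hS : IsCompact S := (isCompact_closedBall x₀ (2 * ρ)).diff isOpen_ball
  have hSΩ : S ⊆ Ω := sdiff_subset.trans hbig
  have hgap : ∃ γ > 0, ∀ y ∈ S, ubarF Ω u y < φ y - γ := by
    rcases S.eq_empty_or_nonempty with hemp | hne
    · exact ⟨1, one_pos, by simp [hemp]⟩
    · obtain ⟨y, hy, hmin⟩ := hS.exists_isMinOn hne (f := fun y => φ y - ubarF Ω u y)
        ((hφ.mono hSΩ).sub (hcont.mono (hSΩ.trans subset_closure)))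
      have hyne : y ≠ x₀ := by
        rintro rfl
        exact hy.2 (mem_ball_self hρ0)
      have hpos := hlt y (hSΩ hy) hyne
      refine ⟨(φ y - ubarF Ω u y) / 2, by linarith, fun z hz => ?_⟩
      have : φ y - ubarF Ω u y ≤ φ z - ubarF Ω u z := hmin hz
      linarith
  obtain ⟨γ, hγ, hgap⟩ := hgap
  obtain ⟨δ, hδ, hle⟩ := eventually_le_of_ubarF_lt hb hS (hSΩ.trans subset_closure)
    (ψ := fun y => φ y - γ) ((hφ.mono hSΩ).sub continuousOn_const) hgap
  have hin : ∀ ε, 0 < ε → ε < min δ ρ → ∀ x ∈ closedBall x₀ ρ, u ε x - φ x ≤ -γ := by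
    intro ε h0 h1
    refine hcomp ρ hρ0 hρ1 hsmall ε h0 (h1.trans_le ((min_le_right _ _).trans hρ1.le)) (-γ) ?_
    intro x hx y hy hny
    have h2 := dist_triangle y x x₀
    have h3 := mem_closedBall.1 hx
    have h4 := mem_closedBall.1 hy
    have h5 := h1.trans_le (min_le_right _ _)
    have := hle ε h0 (h1.trans_le (min_le_left _ _)) y ⟨mem_closedBall.2 (by linarith),
      fun hyb => hny (ball_subset_closedBall hyb)⟩
    linarith
  obtain ⟨δ₂, hδ₂, hc⟩ := Metric.continuousAt_iff.1 (hφ.continuousAt (hΩo.mem_nhds hx₀))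
    (γ / 2) (half_pos hγ)
  have hfin : ubarF Ω u x₀ ≤ φ x₀ - γ / 2 := by
    refine ubarF_le hb (subset_closure hx₀) (δ := min (min δ ρ) (δ₂ / 2)) (by positivity)
      fun ε h0 h1 y hy hd => ?_
    have h2 := hin ε h0 (h1.trans_le (min_le_left _ _)) y
      (mem_closedBall.2 (hd.trans ((min_le_left _ _).trans (min_le_right _ _))))
    have h3 := hc (hd.trans_lt ((min_le_right _ _).trans_lt (by linarith)))
    rw [Real.dist_eq] at h3
    have := (abs_lt.1 h3).2
    linarith
  linarith

lemma isViscSubsol_ubarF (hN : 2 ≤ N) {p q : ℝ} (hp : 2 ≤ p)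
    (hq : q = ((N : ℝ) + 2) / ((N : ℝ) + p)) {Ω : Set (EucN N)} (hΩo : IsOpen Ω)
    (hΩb : Bornology.IsBounded Ω) {F : EucN N → ℝ} {u : ℝ → EucN N → ℝ}
    (hu : ∀ ε : ℝ, 0 < ε → IsMVS q ε Ω F (u ε)) (hb : LocBdd Ω u)
    (hcont : ContinuousOn (ubarF Ω u) (closure Ω)) : IsViscSubsol p Ω (ubarF Ω u) := by
  intro x₀ hx₀ φ hφ heq hlt
  by_contra! hneg
  obtain ⟨r, hr, h⟩ := exists_ball_mveOp_le hN hp hq (hφ.contDiffAt (hΩo.mem_nhds hx₀))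
    (neg_pos.2 hneg)
  refine not_strict_touching_of_comparison hΩo hb hcont hφ.continuousOn hx₀ heq hlt hr
    fun ρ hρ hρr hsub ε h0 h1 m hm => ?_
  obtain ⟨B, hB⟩ := (isCompact_closedBall x₀ ρ).bddBelow_image (hφ.continuousOn.mono hsub)
  have hball : closedBall x₀ ρ ⊆ ball x₀ r := closedBall_subset_ball hρr
  refine (hu ε h0).sub_le hN hp hq h0 hΩb (hsub.trans subset_closure)
    (fun x hx => hB (mem_image_of_mem _ hx)) (fun x hx => (h x (hball hx) ε h0 h1).1)
    (fun x hx ξ hξ => (h x (hball hx) ε h0 h1).2 ξ hξ ?_) hm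
  rw [neg_neg]
  exact dirLap_le_domLap hp φ x₀ hξ

lemma isViscSupersol_ulowF (hN : 2 ≤ N) {p q : ℝ} (hp : 2 ≤ p)
    (hq : q = ((N : ℝ) + 2) / ((N : ℝ) + p)) {Ω : Set (EucN N)} (hΩo : IsOpen Ω)
    (hΩb : Bornology.IsBounded Ω) {F : EucN N → ℝ} {u : ℝ → EucN N → ℝ}
    (hu : ∀ ε : ℝ, 0 < ε → IsMVS q ε Ω F (u ε)) (hb : LocBdd Ω u)
    (hcont : ContinuousOn (ubarF Ω fun ε x => -u ε x) (closure Ω)) :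
    IsViscSupersol p Ω (ulowF Ω u) := by
  intro x₀ hx₀ φ hφ heq hlt
  by_contra! hpos
  obtain ⟨ξ, hξ, hd⟩ : ∃ ξ : EucN N, ‖ξ‖ = 1 ∧ domLap p φ x₀ / 2 < dirLap p φ x₀ ξ := by
    by_contra! hall
    have := domLap_le hN hp hall
    linarith
  have hφx := hφ.contDiffAt (hΩo.mem_nhds hx₀)
  obtain ⟨r, hr, h⟩ := exists_ball_mveOp_le hN hp hq (φ := fun y => -1 * φ y) (x₀ := x₀)
    (contDiffAt_const.mul hφx) (half_pos hpos)
  refine not_strict_touching_of_comparison (φ := fun y => -φ y) hΩo hb.neg hcont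
    hφ.continuousOn.neg hx₀ ?_ ?_ hr fun ρ hρ hρr hsub ε h0 h1 m hm => ?_
  · rw [heq, ulowF_eq_neg_ubarF, neg_neg]
  · intro x hx hne
    have := hlt x hx hne
    rw [ulowF_eq_neg_ubarF] at this
    exact lt_neg.1 this
  obtain ⟨B, hB⟩ := (isCompact_closedBall x₀ ρ).bddAbove_image (hφ.continuousOn.mono hsub)
  have hball : closedBall x₀ ρ ⊆ ball x₀ r := closedBall_subset_ball hρr
  have hfin := (hu ε h0).le_sub hN hp hq h0 hΩb (hsub.trans subset_closure) (Ψ := φ) (m := m)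
    (fun x hx => hB (mem_image_of_mem _ hx)) (fun x hx => ?_) (fun x hx => ⟨ξ, hξ, ?_⟩)
    (fun x hx y hy hny => ?_)
  · intro x hx
    have := hfin x hx
    linarith
  · have := (h x (hball hx) ε h0 h1).1.neg
    simpa using this
  · have := (h x (hball hx) ε h0 h1).2 ξ hξ (by
      rw [dirLap_const_mul hφx]; linarith)
    rw [mveOp_const_mul] at this
    linarith
  · have := hm x hx y hy hny
    linarith

section Schwartz

open LineDeriv Laplacian SchwartzMap

/-- The constant coefficient operator `Δ + (p - 2) ∂_ξ²` on Schwartz functions. -/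
def schwartzLap {V : Type*} [NormedAddCommGroup V] [NormedSpace ℝ V] (p : ℝ) (ξ : EucN N)
    (f : 𝓢(EucN N, V)) : 𝓢(EucN N, V) :=
  (∑ i : Fin N, ∂_{EuclideanSpace.single i (1 : ℝ)} (∂_{EuclideanSpace.single i (1 : ℝ)} f)) +
    (p - 2) • ∂_{ξ} (∂_{ξ} f)

lemma lineDerivOp_lineDerivOp_apply (f : 𝓢(EucN N, ℝ)) (ξ x : EucN N) :
    (∂_{ξ} (∂_{ξ} f)) x = hessQF f x ξ := by
  have h := SchwartzMap.iteratedLineDerivOp_eq_iteratedFDeriv (m := ![ξ, ξ]) (f := f) (x := x)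
  rw [hessQF, ← h]
  simp [iteratedLineDerivOp_succ_left]

lemma schwartzLap_apply (p : ℝ) (ξ : EucN N) (f : 𝓢(EucN N, ℝ)) (x : EucN N) :
    schwartzLap p ξ f x = dirLap p f x ξ := by
  simp [schwartzLap, dirLap, lineDerivOp_lineDerivOp_apply]

lemma lineDerivOp_postcompCLM (L : ℂ →L[ℝ] ℝ) (g : 𝓢(EucN N, ℂ)) (v : EucN N) :
    ∂_{v} (g.postcompCLM L) = (∂_{v} g).postcompCLM L := by
  ext x
  have h := L.hasFDerivAt.comp x (g.hasFDerivAt x)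
  rw [SchwartzMap.postcompCLM_apply, SchwartzMap.lineDerivOp_apply_eq_fderiv,
    SchwartzMap.lineDerivOp_apply_eq_fderiv]
  have h2 : fderiv ℝ (g.postcompCLM L) x = L.comp (fderiv ℝ g x) := h.fderiv
  rw [h2]
  rfl

lemma schwartzLap_postcompCLM (p : ℝ) (ξ : EucN N) (L : ℂ →L[ℝ] ℝ) (g : 𝓢(EucN N, ℂ)) :
    schwartzLap p ξ (g.postcompCLM L) = (schwartzLap p ξ g).postcompCLM L := by
  simp only [schwartzLap, lineDerivOp_postcompCLM, map_add, map_sum, map_smul]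

lemma schwartzLap_eq_fourierMultiplierCLM (p : ℝ) (ξ : EucN N) (g : 𝓢(EucN N, ℂ)) :
    schwartzLap p ξ g = -(2 * Real.pi) ^ 2 •
      fourierMultiplierCLM ℂ (fun ζ : EucN N => ‖ζ‖ ^ 2 + (p - 2) * (inner ℝ ζ ξ) ^ 2) g := by
  have h1 : (∑ i : Fin N, ∂_{EuclideanSpace.single i (1 : ℝ)}
      (∂_{EuclideanSpace.single i (1 : ℝ)} g)) = Δ g := by
    rw [SchwartzMap.laplacian_eq_sum (EuclideanSpace.basisFun (Fin N) ℝ)]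
    simp
  have hg1 : (fun ζ : EucN N => inner ℝ ζ ξ).HasTemperateGrowth := by fun_prop
  have h2 : ∂_{ξ} (∂_{ξ} g) = -(2 * Real.pi) ^ 2 •
      fourierMultiplierCLM ℂ (fun ζ : EucN N => (inner ℝ ζ ξ) ^ 2) g := by
    rw [lineDeriv_eq_fourierMultiplierCLM, lineDeriv_eq_fourierMultiplierCLM,
      ← fourierMultiplierCLM_ofReal ℂ hg1, map_smul, smul_smul,
      fourierMultiplierCLM_ofReal ℂ hg1,
      fourierMultiplierCLM_fourierMultiplierCLM_apply hg1 hg1]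
    have : ((2 * Real.pi * Complex.I) * (2 * Real.pi * Complex.I) : ℂ) =
        ((-(2 * Real.pi) ^ 2 : ℝ) : ℂ) := by
      push_cast
      linear_combination (4 * (Real.pi : ℂ) ^ 2) * Complex.I_mul_I
    rw [this]
    congr 1
    have h0 : ((fun ζ : EucN N => inner ℝ ζ ξ) * fun ζ => inner ℝ ζ ξ) =
        fun ζ => (inner ℝ ζ ξ) ^ 2 := by
      ext ζ; simp [sq]
    ext x
    simp [h0]
  have h3 : (fun ζ : EucN N => ‖ζ‖ ^ 2).HasTemperateGrowth := by fun_prop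
  have h4 : (fun ζ : EucN N => (inner ℝ ζ ξ) ^ 2).HasTemperateGrowth := by fun_prop
  have h5 : fourierMultiplierCLM ℂ (fun ζ : EucN N => ‖ζ‖ ^ 2 + (p - 2) * (inner ℝ ζ ξ) ^ 2) g =
      fourierMultiplierCLM ℂ (fun ζ : EucN N => ‖ζ‖ ^ 2) g +
        (p - 2) • fourierMultiplierCLM ℂ (fun ζ : EucN N => (inner ℝ ζ ξ) ^ 2) g := by
    have h6 : ((p - 2) • fun ζ : EucN N => (inner ℝ ζ ξ) ^ 2).HasTemperateGrowth := by
      change (fun ζ : EucN N => (p - 2) * (inner ℝ ζ ξ) ^ 2).HasTemperateGrowth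
      fun_prop
    rw [← smul_apply, ← fourierMultiplierCLM_smul h4]
    simp only [fourierMultiplierCLM_apply]
    rw [← FourierTransform.fourierInv_add, ← _root_.add_apply, ← smulLeftCLM_add h3 h6]
    rfl
  rw [schwartzLap, h1, h2, laplacian_eq_fourierMultiplierCLM, h5, smul_add,
    smul_comm (p - 2)]

/-- Solvability of the resolvent equation in the Schwartz space. -/
lemma exists_resolvent {p T : ℝ} (hp : 2 ≤ p) (hT : 0 ≤ T) (ξ : EucN N) (f : 𝓢(EucN N, ℝ)) :
    ∃ h : 𝓢(EucN N, ℝ), ∀ x, h x - T * schwartzLap p ξ h x = f x := by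
  set s : ℝ := 2 * Real.pi * √T with hs
  set B : EucN N →L[ℝ] WithLp 2 (EucN N × ℝ) :=
    (WithLp.prodContinuousLinearEquiv 2 ℝ (EucN N) ℝ).symm.toContinuousLinearMap.comp
      ((s • ContinuousLinearMap.id ℝ (EucN N)).prod ((s * √(p - 2)) • innerSL ℝ ξ)) with hB
  have hBn : ∀ ζ, ‖B ζ‖ ^ 2 =
      T * (2 * Real.pi) ^ 2 * (‖ζ‖ ^ 2 + (p - 2) * (inner ℝ ζ ξ) ^ 2) := by
    intro ζ
    rw [WithLp.prod_norm_sq_eq_of_L2]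
    have h1 : (B ζ).fst = s • ζ := rfl
    have h2 : (B ζ).snd = (s * √(p - 2)) * inner ℝ ξ ζ := rfl
    have h3 := Real.sq_sqrt hT
    have h4 := Real.sq_sqrt (sub_nonneg.2 hp)
    rw [h1, h2, norm_smul, Real.norm_eq_abs, Real.norm_eq_abs, mul_pow, sq_abs, sq_abs,
      real_inner_comm, mul_pow (s * √(p - 2)), mul_pow s, h4, hs, mul_pow _ √T, h3]
    ring
  set g₀ : EucN N → ℝ := fun ζ => ‖ζ‖ ^ 2 + (p - 2) * (inner ℝ ζ ξ) ^ 2 with hg₀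
  set m : EucN N → ℝ := fun ζ => 1 + ‖B ζ‖ ^ 2 with hm
  set m' : EucN N → ℝ := fun ζ => (1 + ‖B ζ‖ ^ 2) ^ (-1 : ℝ) with hm'
  have hBt : (fun ζ => B ζ).HasTemperateGrowth := B.hasTemperateGrowth
  have hm't : m'.HasTemperateGrowth :=
    (Function.hasTemperateGrowth_one_add_norm_sq_rpow _ (-1)).comp hBt
  have hg₀t : g₀.HasTemperateGrowth := by fun_prop
  have hmt : m.HasTemperateGrowth := by
    have h := (Function.hasTemperateGrowth_norm_sq (WithLp 2 (EucN N × ℝ))).comp hBt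
    exact (Function.HasTemperateGrowth.const 1).add h
  have hmm : m * m' = fun _ => 1 := by
    ext ζ
    have : (1 + ‖B ζ‖ ^ 2) ≠ 0 := by positivity
    simp only [Pi.mul_apply, hm, hm', Real.rpow_neg_one]
    field_simp
  have hmg : m = (fun _ => (1 : ℝ)) + (T * (2 * Real.pi) ^ 2) • g₀ := by
    ext ζ
    simp [hm, hBn, hg₀]
  set fc : 𝓢(EucN N, ℂ) := f.postcompCLM Complex.ofRealCLM with hfc
  set hc : 𝓢(EucN N, ℂ) := fourierMultiplierCLM ℂ m' fc with hhc
  have h1 : fourierMultiplierCLM ℂ m hc = fc := by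
    rw [hhc, fourierMultiplierCLM_fourierMultiplierCLM_apply hmt hm't, hmm,
      fourierMultiplierCLM_const]
    simp
  have h6 : ((T * (2 * Real.pi) ^ 2) • g₀).HasTemperateGrowth := by
    change (fun ζ => (T * (2 * Real.pi) ^ 2) * g₀ ζ).HasTemperateGrowth
    fun_prop
  have h2 : fourierMultiplierCLM ℂ m hc = hc - T • schwartzLap p ξ hc := by
    have h3 : fourierMultiplierCLM ℂ m hc = fourierMultiplierCLM ℂ (fun _ : EucN N => (1 : ℝ)) hc +
        fourierMultiplierCLM ℂ ((T * (2 * Real.pi) ^ 2) • g₀) hc := by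
      simp only [fourierMultiplierCLM_apply]
      rw [← FourierTransform.fourierInv_add, ← _root_.add_apply, ← smulLeftCLM_add (by fun_prop) h6,
        ← hmg]
    rw [h3, fourierMultiplierCLM_const, fourierMultiplierCLM_smul hg₀t,
      schwartzLap_eq_fourierMultiplierCLM]
    ext x
    simp
    ring
  refine ⟨hc.postcompCLM Complex.reCLM, fun x => ?_⟩
  rw [schwartzLap_postcompCLM]
  have h4 := congrArg (fun k : 𝓢(EucN N, ℂ) => (k x).re) (h2.symm.trans h1)
  simpa [hfc] using h4

end Schwartz

section Schwartz

open LineDeriv SchwartzMap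

lemma SchwartzMap.exists_abs_le (f : 𝓢(EucN N, ℝ)) : ∃ C, ∀ x, |f x| ≤ C :=
  ⟨_, fun x => f.toBoundedContinuousFunction.norm_coe_le_norm x⟩

lemma SchwartzMap.integrable_mul_schwartz (f g : 𝓢(EucN N, ℝ)) :
    Integrable fun x => f x * g x := by
  obtain ⟨C, hC⟩ := f.exists_abs_le
  exact g.integrable.bdd_mul (c := C) f.continuous.aestronglyMeasurable
    (Eventually.of_forall hC)

lemma integral_mul_schwartzLap (p : ℝ) (ξ : EucN N) (f g : 𝓢(EucN N, ℝ)) :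
    ∫ x, f x * schwartzLap p ξ g x = ∫ x, schwartzLap p ξ f x * g x := by
  have key : ∀ v : EucN N, ∫ x, f x * (∂_{v} (∂_{v} g)) x = ∫ x, (∂_{v} (∂_{v} f)) x * g x := by
    intro v
    rw [integral_mul_lineDerivOp_right_eq_neg_left, ← neg_eq_iff_eq_neg.2
      (integral_mul_lineDerivOp_right_eq_neg_left (∂_{v} f) g v)]
  simp only [schwartzLap, _root_.add_apply, _root_.sum_apply, _root_.smul_apply, smul_eq_mul,
    mul_add, add_mul, Finset.mul_sum, Finset.sum_mul]
  have e1 : ∀ x, f x * ((p - 2) * (∂_{ξ} (∂_{ξ} g)) x) = (p - 2) * (f x * (∂_{ξ} (∂_{ξ} g)) x) :=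
    fun x => by ring
  have e2 : ∀ x, (p - 2) * (∂_{ξ} (∂_{ξ} f)) x * g x = (p - 2) * ((∂_{ξ} (∂_{ξ} f)) x * g x) :=
    fun x => by ring
  simp only [e1, e2]
  rw [integral_add (integrable_finsetSum _ fun i _ => f.integrable_mul_schwartz _)
      ((f.integrable_mul_schwartz _).const_mul _),
    integral_add (integrable_finsetSum _ fun i _ => SchwartzMap.integrable_mul_schwartz _ g)
      ((SchwartzMap.integrable_mul_schwartz _ g).const_mul _),
    integral_finsetSum _ fun i _ => f.integrable_mul_schwartz _,
    integral_finsetSum _ fun i _ => SchwartzMap.integrable_mul_schwartz _ g,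
    integral_const_mul, integral_const_mul, key]
  simp only [key]

/-- Maximum principle for the resolvent equation, with a quadratic majorant. -/
lemma resolvent_le_quadratic {p T : ℝ} (hp : 2 ≤ p) (hT : 0 ≤ T) {ξ : EucN N} (hξ : ‖ξ‖ = 1)
    {h : 𝓢(EucN N, ℝ)} {f : EucN N → ℝ} (hh : ∀ x, h x - T * schwartzLap p ξ h x = f x)
    {A a : ℝ} (hA : 0 ≤ A) (ha : 0 ≤ a) (z : EucN N) (hf : ∀ y, f y ≤ A + a * ‖y - z‖ ^ 2)
    (y : EucN N) : h y ≤ A + a * ‖y - z‖ ^ 2 + a * (2 * (N + p - 2)) * T := by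
  by_contra! hlt
  have hNp : 0 ≤ a * (2 * ((N : ℝ) + p - 2)) * T := by
    have : (0 : ℝ) ≤ N + p - 2 := by
      have : (0 : ℝ) ≤ N := N.cast_nonneg
      linarith
    positivity
  set g : EucN N → ℝ := fun x => h x + -a * ‖x - z‖ ^ 2 with hg
  have hgc : Continuous g := by
    have := h.continuous
    fun_prop
  have hgy : 0 < g y := by simp only [hg]; linarith
  have hev : ∀ᶠ x in cocompact (EucN N), g x ≤ g y := by
    have h1 := (h.tendsto_cocompact).eventually (gt_mem_nhds hgy)
    filter_upwards [h1] with x hx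
    have : 0 ≤ a * ‖x - z‖ ^ 2 := by positivity
    simp only [hg] at hx ⊢
    linarith
  obtain ⟨x, hx⟩ := hgc.exists_forall_ge' y hev
  have hh2 : ContDiffAt ℝ 2 h x := (h.smooth 2).contDiffAt
  have hq2 : ContDiffAt ℝ 2 (fun x => ‖x - z‖ ^ 2) x := (contDiff_normSq_sub z).contDiffAt
  have hq3 : ContDiffAt ℝ 2 (fun x => -a * ‖x - z‖ ^ 2) x := contDiffAt_const.mul hq2
  have hmax : IsLocalMax g x := Eventually.of_forall hx
  have hgd : ContDiffAt ℝ 2 g x := hh2.add hq3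
  have hd : dirLap p g x ξ ≤ 0 := by
    have h1 := hessQF_nonpos_of_isLocalMax hgd hmax ξ
    have h2 : ∑ i : Fin N, hessQF g x (EuclideanSpace.single i 1) ≤ 0 :=
      Finset.sum_nonpos fun i _ => hessQF_nonpos_of_isLocalMax hgd hmax _
    have h3 := mul_nonpos_of_nonneg_of_nonpos (sub_nonneg.2 hp) h1
    simp only [dirLap]; linarith
  rw [hg, dirLap_add hh2 hq3, dirLap_const_mul hq2, dirLap_normSq z x hξ] at hd
  have h1 := hh x
  rw [schwartzLap_apply] at h1
  have h2 := hf x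
  have h3 : T * dirLap p h x ξ ≤ T * (a * (2 * (N + p - 2))) := by
    gcongr; linarith
  have h4 := hx y
  simp only [hg] at h4
  linarith

lemma abs_resolvent_le {p T : ℝ} (hp : 2 ≤ p) (hT : 0 ≤ T) {ξ : EucN N} (hξ : ‖ξ‖ = 1)
    {h : 𝓢(EucN N, ℝ)} {f : EucN N → ℝ} (hh : ∀ x, h x - T * schwartzLap p ξ h x = f x)
    {A : ℝ} (hf : ∀ y, |f y| ≤ A) (y : EucN N) : |h y| ≤ A := by
  have hA : 0 ≤ A := (abs_nonneg _).trans (hf y)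
  rw [abs_le]
  constructor
  · have hh' : ∀ x, (-h) x - T * schwartzLap p ξ (-h) x = -f x := by
      intro x
      have e : schwartzLap p ξ (-h) x = - schwartzLap p ξ h x := by
        have h2 : ContDiffAt ℝ 2 h x := (h.smooth 2).contDiffAt
        rw [schwartzLap_apply, schwartzLap_apply]
        have : (⇑(-h) : EucN N → ℝ) = fun y => -1 * h y := by
          ext y; simp
        rw [this, dirLap_const_mul h2]; ring
      rw [e, ← hh x, _root_.neg_apply]; ring
    have := resolvent_le_quadratic hp hT hξ hh' hA le_rfl 0
      (fun y => by have := (abs_le.1 (hf y)).1; linarith) y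
    simp only [_root_.neg_apply] at this
    linarith
  · have := resolvent_le_quadratic hp hT hξ hh hA le_rfl 0
      (fun y => by have := (abs_le.1 (hf y)).2; linarith) y
    linarith

/-- A smooth function touching a viscosity supersolution from below is a supersolution there. -/
lemma dirLap_nonpos_of_touching {p : ℝ} (hp : 2 ≤ p) {Ω : Set (EucN N)} {W : EucN N → ℝ}
    (hW : IsViscSupersol p Ω W) {h : EucN N → ℝ} (hh : ContDiff ℝ 2 h) {x : EucN N} (hx : x ∈ Ω)
    (hle : ∀ y ∈ Ω, h y - W y ≤ h x - W x) {ξ : EucN N} (hξ : ‖ξ‖ = 1) : dirLap p h x ξ ≤ 0 := by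
  have hq := (contDiff_quartic x).contDiffAt (x := x)
  have hq' : ContDiffAt ℝ 2 (fun y => -1 * (‖y - x‖ ^ 2) ^ 2) x := contDiffAt_const.mul hq
  have hhc : ContDiffAt ℝ 2 (fun y => h y + (W x - h x)) x := hh.contDiffAt.add contDiffAt_const
  have h1 := hW x hx (fun y => (h y + (W x - h x)) + -1 * (‖y - x‖ ^ 2) ^ 2)
    ((hh.add contDiff_const).add (contDiff_const.mul (contDiff_quartic x))).contDiffOn
    (by simp) (fun y hy hne => by
      have h2 := hle y hy
      have h3 : 0 < (‖y - x‖ ^ 2) ^ 2 := by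
        have := norm_pos_iff.2 (sub_ne_zero.2 hne)
        positivity
      linarith)
  have h2 := (dirLap_le_domLap hp _ x hξ).trans h1
  rw [dirLap_add hhc hq', dirLap_add_const, dirLap_const_mul hq,
    dirLap_quartic] at h2
  linarith

lemma exists_resolvent_le {p : ℝ} (hp : 2 ≤ p) {Ω : Set (EucN N)}
    {W : EucN N → ℝ} (hWc : ContinuousOn W Ω) (hW : IsViscSupersol p Ω W) (hW1 : ∀ y ∈ Ω, 1 ≤ W y)
    {S : Set (EucN N)} (hS : IsCompact S) {ρ : ℝ} (hρ : 0 < ρ) (hSΩ : cthickening ρ S ⊆ Ω)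
    {C : ℝ} (hC : 0 ≤ C) {ξ : EucN N} (hξ : ‖ξ‖ = 1) :
    ∃ T₀ > 0, ∀ T, 0 < T → T < T₀ → ∀ g h : 𝓢(EucN N, ℝ), (∀ y, g y ≤ C) → (∀ y ∉ S, g y ≤ 0) →
      ∀ s, 0 ≤ s → (∀ y ∈ Ω, g y ≤ W y + s) → (∀ x, h x - T * schwartzLap p ξ h x = g x) →
      ∀ y ∈ Ω, h y ≤ W y + s := by
  set D := C / ρ ^ 2 * (2 * (N + p - 2)) with hD
  have hNp : (0 : ℝ) ≤ N + p - 2 := by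
    have : (0 : ℝ) ≤ N := N.cast_nonneg
    linarith
  have hD0 : 0 ≤ D := by positivity
  refine ⟨1 / (D + 1), by positivity, fun T hT hT' g h hgC hgS s hs hgW hh y hy => ?_⟩
  have hDT : D * T ≤ 1 := by
    rw [lt_div_iff₀ (by positivity)] at hT'
    linarith
  have hout : ∀ z ∉ cthickening ρ S, h z ≤ 1 := by
    intro z hz
    have := resolvent_le_quadratic hp hT.le hξ hh le_rfl (by positivity : 0 ≤ C / ρ ^ 2) z
      (fun y => ?_) z
    · simp only [sub_self, norm_zero] at this
      linarith
    · by_cases hyS : y ∈ S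
      · have hd : ρ ≤ ‖y - z‖ := by
          by_contra! hlt
          exact hz (mem_cthickening_of_dist_le z y ρ S hyS (by
            rw [dist_comm, dist_eq_norm]; exact hlt.le))
        have h1 : ρ ^ 2 ≤ ‖y - z‖ ^ 2 := by gcongr
        have h2 : C / ρ ^ 2 * ρ ^ 2 ≤ C / ρ ^ 2 * ‖y - z‖ ^ 2 := by gcongr
        rw [div_mul_cancel₀ _ (by positivity)] at h2
        linarith [hgC y]
      · have : 0 ≤ C / ρ ^ 2 * ‖y - z‖ ^ 2 := by positivity
        linarith [hgS y hyS]
  by_contra! hlt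
  have hyK : y ∈ cthickening ρ S := by
    by_contra hn
    linarith [hout y hn, hW1 y hy]
  obtain ⟨x, hx, hmax⟩ := (hS.cthickening (r := ρ)).exists_isMaxOn ⟨y, hyK⟩
    (f := fun z => h z - W z) (h.continuous.continuousOn.sub (hWc.mono hSΩ))
  have hxy : h y - W y ≤ h x - W x := hmax hyK
  have hd := dirLap_nonpos_of_touching hp hW (h.smooth 2) (hSΩ hx) (fun z hz => ?_) hξ
  · have h1 := hh x
    rw [schwartzLap_apply] at h1
    have h2 := mul_nonpos_of_nonneg_of_nonpos hT.le hd
    linarith [hgW x (hSΩ hx)]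
  · by_cases hzK : z ∈ cthickening ρ S
    · exact hmax hzK
    · linarith [hout z hzK, hW1 z hz]

end Schwartz

section Schwartz

open SchwartzMap

lemma exists_schwartz_approx {f : EucN N → ℝ} (hf : Continuous f) (hfs : HasCompactSupport f)
    {ρ τ : ℝ} (hρ : 0 < ρ) (hτ : 0 < τ) :
    ∃ g : 𝓢(EucN N, ℝ), (∀ x, |g x - f x| ≤ τ) ∧ ∀ x ∉ cthickening ρ (tsupport f), g x = 0 := by
  obtain ⟨δ, hδ, hfδ⟩ := Metric.uniformContinuous_iff.1
    (hf.uniformContinuous_of_tendsto_cocompact hfs.is_zero_at_infty) τ hτ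
  obtain ⟨g, hgc, hg⟩ := hf.exists_contDiff_dist_le_of_forall_mem_ball_dist_le
    (lt_min hρ hδ)
  have hg0 : ∀ x ∉ cthickening ρ (tsupport f), g x = 0 := by
    intro x hx
    have hz : ∀ y ∈ ball x (min ρ δ), f y = 0 := by
      intro y hy
      by_contra hne
      refine hx (mem_cthickening_of_dist_le x y ρ _ (subset_tsupport f hne) ?_)
      rw [dist_comm]
      exact (mem_ball.1 hy).le.trans (min_le_left _ _)
    have hx0 := hz x (mem_ball_self (lt_min hρ hδ))
    have := hg x 0 fun y hy => by rw [hz y hy, hx0, dist_self]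
    rw [hx0] at this
    exact dist_le_zero.1 this
  have hgs : HasCompactSupport g :=
    HasCompactSupport.intro (hfs.isCompact.cthickening (r := ρ)) hg0
  refine ⟨hgs.toSchwartzMap hgc, fun x => ?_, hg0⟩
  have := hg x τ fun y hy => (hfδ ((mem_ball.1 hy).trans_le (min_le_right _ _))).le
  rwa [Real.dist_eq] at this

/-- A viscosity supersolution is a distributional supersolution of every operator
`Δ + (p - 2) ∂_ξ²`. -/
lemma integral_mul_schwartzLap_nonpos {p : ℝ} (hp : 2 ≤ p) {Ω : Set (EucN N)} (hΩo : IsOpen Ω)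
    {W : EucN N → ℝ} (hWc : ContinuousOn W Ω) (hW : IsViscSupersol p Ω W)
    (hW1 : ∀ y ∈ Ω, 1 ≤ W y) {f : EucN N → ℝ} (hf : Continuous f) (hfs : HasCompactSupport f)
    (hfΩ : tsupport f ⊆ Ω) (hfW : ∀ y ∈ Ω, f y ≤ W y) {φ : 𝓢(EucN N, ℝ)} (hφ0 : ∀ y, 0 ≤ φ y)
    (hφ : ∀ y, φ y ≠ 0 → y ∈ Ω ∧ f y = W y) {ξ : EucN N} (hξ : ‖ξ‖ = 1) :
    ∫ y, f y * schwartzLap p ξ φ y ≤ 0 := by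
  obtain ⟨r, hr, hrΩ⟩ := hfs.isCompact.exists_cthickening_subset_open hΩo hfΩ
  obtain ⟨C, hC⟩ := hf.bounded_above_of_compact_support hfs
  have hC0 : 0 ≤ C := (norm_nonneg _).trans (hC 0)
  set S := cthickening (r / 2) (tsupport f) with hSdef
  have hS : IsCompact S := hfs.isCompact.cthickening
  have hSΩ : cthickening (r / 2) S ⊆ Ω := by
    refine (cthickening_cthickening_subset (by positivity) (by positivity) _).trans ?_
    rwa [add_halves]
  obtain ⟨T₀, hT₀, hres⟩ := exists_resolvent_le hp hWc hW hW1 hS (half_pos hr) hSΩ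
    (by positivity : 0 ≤ C + 1) hξ
  set L := schwartzLap p ξ φ with hL
  set LL := schwartzLap p ξ L with hLL
  set I₀ := ∫ y, φ y with hI₀
  set I₁ := ∫ y, |L y| with hI₁
  set I₂ := ∫ y, |LL y| with hI₂
  have hI₁0 : 0 ≤ I₁ := integral_nonneg fun y => abs_nonneg _
  have hfL : Integrable fun y => f y * L y :=
    L.integrable.bdd_mul (c := C) hf.aestronglyMeasurable (Eventually.of_forall hC)
  have key : ∀ T, 0 < T → T < min T₀ 1 →
      ∫ y, f y * L y ≤ T * (I₁ + 2 * I₀ + (C + 1) * I₂) := by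
    intro T hT hT'
    have hT0 : T < T₀ := hT'.trans_le (min_le_left _ _)
    have hT1 : T < 1 := hT'.trans_le (min_le_right _ _)
    have hTT : T ^ 2 ≤ T := by nlinarith
    obtain ⟨g, hg, hg0⟩ := exists_schwartz_approx hf hfs (half_pos hr) (pow_pos hT 2)
    have hgC : ∀ y, |g y| ≤ C + 1 := fun y => by
      have h1 := hC y
      have h2 := hg y
      have h3 := abs_sub_abs_le_abs_sub (g y) (f y)
      rw [Real.norm_eq_abs] at h1
      linarith
    obtain ⟨h, hh⟩ := exists_resolvent hp hT.le ξ g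
    have hhW := hres T hT hT0 g h (fun y => (abs_le.1 (hgC y)).2) (fun y hy => (hg0 y hy).le)
      (T ^ 2) (by positivity) (fun y hy => by
        have := (abs_le.1 (hg y)).2
        linarith [hfW y hy]) hh
    have hhb := abs_resolvent_le hp hT.le hξ hh hgC
    have h1 : T * ∫ y, schwartzLap p ξ h y * φ y ≤ T * (2 * T * I₀) := by
      have e : T * (2 * T * I₀) = ∫ y, 2 * T ^ 2 * φ y := by
        rw [integral_const_mul]; ring
      rw [e, ← integral_const_mul]
      refine integral_mono ((SchwartzMap.integrable_mul_schwartz _ _).const_mul _)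
        (φ.integrable.const_mul _) fun y => ?_
      by_cases hy : φ y = 0
      · simp [hy]
      · obtain ⟨hyΩ, hyW⟩ := hφ y hy
        have h2 := hhW y hyΩ
        have h3 := (abs_le.1 (hg y)).1
        have h4 := hh y
        have h5 : T * schwartzLap p ξ h y ≤ 2 * T ^ 2 := by linarith
        have := mul_le_mul_of_nonneg_right h5 (hφ0 y)
        dsimp only
        linarith
    have h1' := le_of_mul_le_mul_left h1 hT
    have h2 : ∫ y, h y * L y = ∫ y, schwartzLap p ξ h y * φ y := integral_mul_schwartzLap p ξ h φ
    have h3 : ∫ y, schwartzLap p ξ h y * L y = ∫ y, h y * LL y :=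
      (integral_mul_schwartzLap p ξ h L).symm
    have h4 : ∫ y, g y * L y =
        (∫ y, h y * L y) - T * ∫ y, schwartzLap p ξ h y * L y := by
      rw [← integral_const_mul, ← integral_sub (h.integrable_mul_schwartz L)
        ((SchwartzMap.integrable_mul_schwartz _ L).const_mul _)]
      refine integral_congr_ae (Eventually.of_forall fun y => ?_)
      dsimp only
      rw [← hh y]; ring
    have h5 : -((C + 1) * I₂) ≤ ∫ y, h y * LL y := by
      rw [hI₂, ← neg_mul, ← integral_const_mul]
      refine integral_mono (LL.integrable.abs.const_mul _) (h.integrable_mul_schwartz LL)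
        fun y => ?_
      have h6 : |h y * LL y| ≤ (C + 1) * |LL y| := by
        rw [abs_mul]; gcongr; exact hhb y
      dsimp only
      have := (abs_le.1 h6).1
      linarith
    have h6 : (∫ y, f y * L y) - ∫ y, g y * L y ≤ T ^ 2 * I₁ := by
      rw [hI₁, ← integral_sub hfL (g.integrable_mul_schwartz L), ← integral_const_mul]
      refine integral_mono (hfL.sub (g.integrable_mul_schwartz L)) (L.integrable.abs.const_mul _)
        fun y => ?_
      have h7 : |(f y - g y) * L y| ≤ T ^ 2 * |L y| := by
        rw [abs_mul, abs_sub_comm]; gcongr; exact hg y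
      dsimp only
      have := (abs_le.1 h7).2
      linarith
    have h7 : T * -((C + 1) * I₂) ≤ T * ∫ y, h y * LL y := by gcongr
    have h8 : T ^ 2 * I₁ ≤ T * I₁ := by gcongr
    rw [h4, h2, h3] at h6
    linarith
  have hlim : Tendsto (fun T : ℝ => T * (I₁ + 2 * I₀ + (C + 1) * I₂)) (𝓝[>] 0) (𝓝 0) := by
    have : Tendsto (fun T : ℝ => T * (I₁ + 2 * I₀ + (C + 1) * I₂)) (𝓝 0)
        (𝓝 (0 * (I₁ + 2 * I₀ + (C + 1) * I₂))) := tendsto_id.mul_const _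
    rw [zero_mul] at this
    exact this.mono_left nhdsWithin_le_nhds
  refine ge_of_tendsto hlim ?_
  filter_upwards [Ioo_mem_nhdsGT (lt_min hT₀ one_pos)] with T hT
  exact key T hT.1 hT.2

end Schwartz

section Schwartz

open LineDeriv SchwartzMap

lemma hessQF_eq_integral {f g ρ : EucN N → ℝ} (hf : Integrable f) {x : EucN N}
    (hg : ContDiffAt ℝ 2 g x) (hgρ : ∀ z, g z = ∫ y, ρ (z - y) * f y) {φ : 𝓢(EucN N, ℝ)}
    (hφ : ∀ y, φ y = ρ (x - y)) (v : EucN N) :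
    hessQF g x v = ∫ y, f y * hessQF φ y v := by
  obtain ⟨C₀, hC₀⟩ := φ.exists_abs_le
  obtain ⟨C, hC⟩ := (∂_{v} (∂_{v} φ)).exists_abs_le
  simp only [lineDerivOp_lineDerivOp_apply] at hC
  have hρ : ∀ (y : EucN N) (t : ℝ), ρ (x + t • v - y) = φ (y - t • v) := fun y t => by
    rw [hφ]; congr 1; abel
  have hρ' : ∀ (y : EucN N) (t : ℝ), ρ (x - t • v - y) = φ (y + t • v) := fun y t => by
    rw [hφ]; congr 1; abel
  have hint : ∀ w : EucN N, Integrable fun y => φ (y + w) * f y := fun w =>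
    hf.bdd_mul (c := C₀) (φ.continuous.comp (continuous_id.add_const w)).aestronglyMeasurable
      (Eventually.of_forall fun y => hC₀ _)
  refine hessQF_eq_of_tendsto hg ?_
  have e : ∀ t : ℝ, (g (x + t • v) + g (x - t • v) - 2 * g x) / t ^ 2
      = ∫ y, f y * ((φ (y + t • v) + φ (y - t • v) - 2 * φ y) / t ^ 2) := by
    intro t
    rw [hgρ, hgρ, hgρ]
    simp only [hρ, hρ', ← hφ]
    have h1 := hint (t • v)
    have h2 := hint (-(t • v))
    have h3 := hint 0
    simp only [← sub_eq_add_neg, add_zero] at h2 h3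
    have h4 : Integrable fun y => φ (y - t • v) * f y + φ (y + t • v) * f y := h2.add h1
    rw [← integral_add h2 h1, ← integral_const_mul, ← integral_sub h4 (h3.const_mul 2),
      ← integral_div]
    refine integral_congr_ae (Eventually.of_forall fun y => ?_)
    dsimp only
    ring
  simp only [e]
  refine tendsto_integral_filter_of_dominated_convergence (fun y => |f y| * C) ?_ ?_
    (hf.abs.mul_const C) ?_
  · refine Eventually.of_forall fun t => hf.aestronglyMeasurable.mul ?_
    refine Continuous.aestronglyMeasurable ?_
    have := φ.continuous
    fun_prop
  · filter_upwards [self_mem_nhdsWithin] with t ht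
    refine Eventually.of_forall fun y => ?_
    have ht2 : 0 < t ^ 2 := sq_pos_of_ne_zero ht
    rw [norm_mul, Real.norm_eq_abs, Real.norm_eq_abs, abs_div, abs_of_pos ht2]
    refine mul_le_mul_of_nonneg_left ((div_le_iff₀ ht2).2 ?_) (abs_nonneg _)
    have := abs_secondDiff_sub_le (φ := φ) (x := y) (v := t • v) (c := 0) (σ := C * t ^ 2)
      (fun s _ => (φ.smooth 2).contDiffAt) fun s _ => by
        rw [hessQF_smul, sub_zero, abs_mul, abs_of_pos ht2, mul_comm]
        gcongr
        exact hC _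
    rwa [sub_zero] at this
  · exact Eventually.of_forall fun y =>
      (tendsto_secondDiff (φ.smooth 2).contDiffAt v).const_mul (f y)

lemma dirLap_eq_integral {p : ℝ} {f g ρ : EucN N → ℝ} (hf : Integrable f) {x : EucN N}
    (hg : ContDiffAt ℝ 2 g x) (hgρ : ∀ z, g z = ∫ y, ρ (z - y) * f y) {φ : 𝓢(EucN N, ℝ)}
    (hφ : ∀ y, φ y = ρ (x - y)) (ξ : EucN N) :
    dirLap p g x ξ = ∫ y, f y * schwartzLap p ξ φ y := by
  have hint : ∀ v : EucN N, Integrable fun y => f y * hessQF φ y v := fun v => by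
    obtain ⟨C, hC⟩ := (∂_{v} (∂_{v} φ)).exists_abs_le
    have := hf.mul_bdd (c := C) (∂_{v} (∂_{v} φ)).continuous.aestronglyMeasurable
      (Eventually.of_forall hC)
    simpa only [lineDerivOp_lineDerivOp_apply] using this
  have e : ∀ y, f y * schwartzLap p ξ φ y
      = (∑ i : Fin N, f y * hessQF φ y (EuclideanSpace.single i 1))
        + (p - 2) * (f y * hessQF φ y ξ) := fun y => by
    rw [schwartzLap_apply, dirLap, mul_add, Finset.mul_sum]; ring
  simp only [e, dirLap, hessQF_eq_integral hf hg hgρ hφ]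
  rw [integral_add (integrable_finsetSum _ fun i _ => hint _) ((hint ξ).const_mul _),
    integral_finsetSum _ fun i _ => hint _, integral_const_mul]

/-- A supersolution is approximated near compact sets by smooth classical supersolutions. -/
lemma exists_smooth_supersol {p : ℝ} (hp : 2 ≤ p) {Ω : Set (EucN N)} (hΩo : IsOpen Ω)
    {W : EucN N → ℝ} (hWc : ContinuousOn W Ω) (hW : IsViscSupersol p Ω W)
    (hW1 : ∀ y ∈ Ω, 1 ≤ W y) {S : Set (EucN N)} (hS : IsCompact S) (hSΩ : S ⊆ Ω)
    {τ : ℝ} (hτ : 0 < τ) :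
    ∃ g : EucN N → ℝ, ContDiff ℝ 2 g ∧ (∀ x ∈ S, |g x - W x| ≤ τ) ∧
      ∀ x ∈ S, ∀ ξ, ‖ξ‖ = 1 → dirLap p g x ξ ≤ 0 := by
  obtain ⟨r, hr, hrΩ⟩ := hS.exists_cthickening_subset_open hΩo hSΩ
  have hS1 : IsCompact (cthickening r S) := hS.cthickening
  obtain ⟨D, hD, hSD, hDΩ⟩ := exists_compact_between hS1 hΩo hrΩ
  obtain ⟨χ, hχ1, hχ0, -, hχ⟩ := exists_continuous_one_zero_of_isCompact hS1
    (isOpen_interior (s := D)).isClosed_compl (disjoint_compl_right_iff_subset.2 hSD)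
  have hχD : tsupport χ ⊆ D := closure_minimal (fun y hy => by
    by_contra hyD
    exact hy (hχ0 fun h => hyD (interior_subset h))) hD.isClosed
  set f : EucN N → ℝ := fun y => χ y * W y with hfdef
  have hft : tsupport f ⊆ tsupport χ := closure_mono fun y hy h => hy (by simp [hfdef, h])
  have hfD : tsupport f ⊆ D := hft.trans hχD
  have hfs : HasCompactSupport f := hD.of_isClosed_subset (isClosed_tsupport f) hfD
  have hf : Continuous f := (χ.continuous.continuousOn.mul hWc).continuous_of_tsupport_subset hΩo
    (hfD.trans hDΩ)
  have hfW : ∀ y ∈ Ω, f y ≤ W y := fun y hy =>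
    mul_le_of_le_one_left (zero_le_one.trans (hW1 y hy)) (hχ y).2
  have hfS : ∀ y ∈ cthickening r S, f y = W y := fun y hy => by simp [hfdef, hχ1 hy]
  obtain ⟨δ, hδ, hfδ⟩ := Metric.uniformContinuous_iff.1
    (hf.uniformContinuous_of_tendsto_cocompact hfs.is_zero_at_infty) τ hτ
  have hm : 0 < min r δ := lt_min hr hδ
  let b : ContDiffBump (0 : EucN N) := ⟨min r δ / 2, min r δ, half_pos hm, half_lt_self hm⟩
  set ρ : EucN N → ℝ := b.normed volume with hρ
  have hρc : ContDiff ℝ ((⊤ : ℕ∞) : WithTop ℕ∞) ρ := b.contDiff_normed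
  have hρs : HasCompactSupport ρ := b.hasCompactSupport_normed
  set g := MeasureTheory.convolution ρ f (ContinuousLinearMap.lsmul ℝ ℝ) volume with hg
  have hgρ : ∀ z, g z = ∫ y, ρ (z - y) * f y := fun z => convolution_lsmul_swap
  have hg2 : ContDiff ℝ 2 g := hρs.contDiff_convolution_left (n := 2) _
    (hρc.of_le (by exact_mod_cast le_top)) hf.locallyIntegrable
  refine ⟨g, hg2, fun x hx => ?_, fun x hx ξ hξ => ?_⟩
  · rw [← hfS x (self_subset_cthickening S hx), ← Real.dist_eq]
    exact b.dist_normed_convolution_le hf.aestronglyMeasurable fun y hy =>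
      (hfδ ((mem_ball.1 hy).trans_le (min_le_right _ _))).le
  · have hc : ContDiff ℝ ((⊤ : ℕ∞) : WithTop ℕ∞) fun y => ρ (x - y) :=
      hρc.comp (contDiff_const.sub contDiff_id)
    have hs : HasCompactSupport fun y => ρ (x - y) :=
      hρs.comp_homeomorph (Homeomorph.subLeft x)
    rw [dirLap_eq_integral (hf.integrable_of_hasCompactSupport hfs) hg2.contDiffAt hgρ
      (φ := hs.toSchwartzMap hc) (fun y => rfl)]
    refine integral_mul_schwartzLap_nonpos hp hΩo hWc hW hW1 hf hfs (hfD.trans hDΩ) hfW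
      (fun y => b.nonneg_normed _) (fun y hy => ?_) hξ
    have hy' : x - y ∈ ball (0 : EucN N) (min r δ) := by
      have : x - y ∈ Function.support ρ := hy
      rwa [hρ, b.support_normed_eq] at this
    have hyS : y ∈ cthickening r S := by
      refine mem_cthickening_of_dist_le y x r _ hx ?_
      rw [mem_ball_zero_iff] at hy'
      rw [dist_comm, dist_eq_norm]
      exact (hy'.trans_le (min_le_left _ _)).le
    exact ⟨hrΩ hyS, hfS y hyS⟩

end Schwartz

lemma IsViscSubsol.add_const {p : ℝ} {Ω : Set (EucN N)} {V : EucN N → ℝ}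
    (hV : IsViscSubsol p Ω V) (a : ℝ) : IsViscSubsol p Ω fun x => V x + a := by
  intro x₀ hx₀ φ hφ h0 hlt
  have := hV x₀ hx₀ (fun x => φ x + -a) (hφ.add contDiffOn_const) (by rw [h0]; ring)
    fun x hx hne => by linarith [hlt x hx hne]
  simpa only [domLap, hessQF_add_const] using this

lemma IsViscSupersol.add_const {p : ℝ} {Ω : Set (EucN N)} {W : EucN N → ℝ}
    (hW : IsViscSupersol p Ω W) (a : ℝ) : IsViscSupersol p Ω fun x => W x + a := by
  intro x₀ hx₀ φ hφ h0 hlt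
  have := hW x₀ hx₀ (fun x => φ x + -a) (hφ.add contDiffOn_const) (by rw [h0]; ring)
    fun x hx hne => by linarith [hlt x hx hne]
  simpa only [domLap, hessQF_add_const] using this

lemma IsViscSubsol.not_dirLap_le_of_isLocalMax (hN : 2 ≤ N) {p : ℝ} (hp : 2 ≤ p)
    {Ω : Set (EucN N)} {V ψ : EucN N → ℝ} (hV : IsViscSubsol p Ω V) {x : EucN N} (hx : x ∈ Ω)
    (hψ : ContDiff ℝ 2 ψ) {C : ℝ} (hC : ∀ y ∈ Ω, V y - ψ y ≤ C)
    (hmax : IsLocalMax (fun y => V y - ψ y) x) {B : ℝ} (hB : B < 0) :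
    ¬ ∀ ξ, ‖ξ‖ = 1 → dirLap p ψ x ξ ≤ B := by
  intro hle
  obtain ⟨s, hs, hball⟩ := Metric.eventually_nhds_iff.1 hmax
  set M := V x - ψ x with hM
  set a := (|C| + |M| + 1) / s ^ 4 with ha
  have ha0 : 0 < a := by positivity
  have haS : a * s ^ 4 = |C| + |M| + 1 := div_mul_cancel₀ _ (by positivity)
  have hq : ContDiff ℝ 2 fun y : EucN N => a * (‖y - x‖ ^ 2) ^ 2 :=
    contDiff_const.mul (contDiff_quartic x)
  have hφ : ContDiff ℝ 2 fun y => (ψ y + a * (‖y - x‖ ^ 2) ^ 2) + M :=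
    (hψ.add hq).add contDiff_const
  have h0 := hV x hx (fun y => (ψ y + a * (‖y - x‖ ^ 2) ^ 2) + M) hφ.contDiffOn
    (by simp [hM]) fun y hy hne => by
      have hpos : 0 < ‖y - x‖ := norm_pos_iff.2 (sub_ne_zero.2 hne)
      by_cases hys : dist y x < s
      · have := hball hys
        have h1 : 0 < a * (‖y - x‖ ^ 2) ^ 2 := by positivity
        linarith
      · rw [dist_eq_norm, not_lt] at hys
        have h1 : a * s ^ 4 ≤ a * (‖y - x‖ ^ 2) ^ 2 := by
          rw [← pow_mul]; gcongr
        linarith [hC y hy, le_abs_self C, neg_abs_le M]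
  have h1 : domLap p (fun y => (ψ y + a * (‖y - x‖ ^ 2) ^ 2) + M) x ≤ B :=
    domLap_le hN hp fun ξ hξ => by
      rw [dirLap_add_const, dirLap_add hψ.contDiffAt hq.contDiffAt,
        dirLap_const_mul (contDiff_quartic x).contDiffAt, dirLap_quartic, mul_zero, add_zero]
      exact hle ξ hξ
  linarith

lemma comparison_of_one_le (hN : 2 ≤ N) {p : ℝ} (hp : 2 ≤ p) {Ω : Set (EucN N)}
    (hΩo : IsOpen Ω) (hΩb : Bornology.IsBounded Ω) {V W : EucN N → ℝ}
    (hVc : ContinuousOn V (closure Ω)) (hWc : ContinuousOn W (closure Ω))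
    (hV : IsViscSubsol p Ω V) (hW : IsViscSupersol p Ω W) (hW1 : ∀ y ∈ Ω, 1 ≤ W y)
    (hbd : ∀ y ∈ frontier Ω, V y ≤ W y) : ∀ x ∈ closure Ω, V x ≤ W x := by
  by_contra! hcon
  obtain ⟨x₀, hx₀, hlt⟩ := hcon
  have hcpt : IsCompact (closure Ω) := hΩb.isCompact_closure
  set D : EucN N → ℝ := fun x => V x - W x with hD
  have hDc : ContinuousOn D (closure Ω) := hVc.sub hWc
  set m := D x₀ with hm
  have hm0 : 0 < m := sub_pos.2 hlt
  have hin : ∀ x ∈ closure Ω, 0 < D x → x ∈ Ω := by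
    intro x hx hpos
    by_contra hxΩ
    have := hbd x ⟨hx, by rwa [hΩo.interior_eq]⟩
    linarith [show D x = V x - W x from rfl]
  set S := closure Ω ∩ D ⁻¹' Ici (m / 2) with hSdef
  have hS : IsCompact S := hcpt.of_isClosed_subset
    (hDc.preimage_isClosed_of_isClosed isClosed_closure isClosed_Ici) inter_subset_left
  have hSΩ : S ⊆ Ω := fun x hx => hin x hx.1 ((half_pos hm0).trans_le hx.2)
  obtain ⟨R, hR⟩ := hcpt.isBounded.exists_norm_le
  set κ := m / 16 / (R ^ 2 + 1) with hκ
  have hκ0 : 0 < κ := by positivity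
  have hκR : ∀ x ∈ closure Ω, κ * ‖x - 0‖ ^ 2 ≤ m / 16 := by
    intro x hx
    have h1 : ‖x - 0‖ ^ 2 ≤ R ^ 2 + 1 := by
      rw [sub_zero]
      have := pow_le_pow_left₀ (norm_nonneg x) (hR x hx) 2
      linarith
    calc κ * ‖x - 0‖ ^ 2 ≤ κ * (R ^ 2 + 1) := by gcongr
      _ = m / 16 := div_mul_cancel₀ _ (by positivity)
  obtain ⟨g, hg, hgW, hgL⟩ := exists_smooth_supersol hp hΩo (hWc.mono subset_closure) hW hW1 hS
    hSΩ (τ := m / 32) (by positivity)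
  have hn : ContDiff ℝ 2 fun x : EucN N => -κ * ‖x - 0‖ ^ 2 :=
    contDiff_const.mul (contDiff_normSq_sub 0)
  set ψ : EucN N → ℝ := fun x => g x + -κ * ‖x - 0‖ ^ 2 with hψ
  have hψ2 : ContDiff ℝ 2 ψ := hg.add hn
  have hEc : ContinuousOn (fun x => V x - ψ x) (closure Ω) := hVc.sub hψ2.continuous.continuousOn
  have hx₀S : x₀ ∈ S := ⟨hx₀, by simp only [mem_preimage, mem_Ici, ← hm]; linarith⟩
  obtain ⟨x, hxS, hxmax⟩ := hS.exists_isMaxOn ⟨x₀, hx₀S⟩ (hEc.mono inter_subset_left)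
  have hmx : V x₀ - ψ x₀ ≤ V x - ψ x := hxmax hx₀S
  have hxΩ : x ∈ Ω := hSΩ hxS
  have hDx : m / 2 < D x := by
    have h1 := abs_le.1 (hgW x hxS)
    have h2 := abs_le.1 (hgW x₀ hx₀S)
    have h3 := hκR x hxS.1
    have h4 : 0 ≤ κ * ‖x₀ - 0‖ ^ 2 := by positivity
    simp only [hψ] at hmx
    have h5 : m = V x₀ - W x₀ := rfl
    have h6 : D x = V x - W x := rfl
    linarith [h1.1, h2.2]
  have hloc : IsLocalMax (fun y => V y - ψ y) x := by
    have hcx : ContinuousAt D x :=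
      (hDc.mono subset_closure).continuousAt (hΩo.mem_nhds hxΩ)
    filter_upwards [hcx.eventually (lt_mem_nhds hDx), hΩo.mem_nhds hxΩ] with y hy hyΩ
    exact hxmax ⟨subset_closure hyΩ, hy.le⟩
  obtain ⟨C, hC⟩ := (hcpt.image_of_continuousOn hEc).bddAbove
  have hNp : (0 : ℝ) < N + p - 2 := by
    have : (2 : ℝ) ≤ N := by exact_mod_cast hN
    linarith
  refine hV.not_dirLap_le_of_isLocalMax hN hp hxΩ hψ2
    (fun y hy => hC (mem_image_of_mem _ (subset_closure hy))) hloc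
    (B := -κ * (2 * (N + p - 2))) (by have := mul_pos hκ0 hNp; linarith) fun ξ hξ => ?_
  rw [hψ, dirLap_add hg.contDiffAt hn.contDiffAt,
    dirLap_const_mul (contDiff_normSq_sub 0).contDiffAt, dirLap_normSq 0 x hξ]
  linarith [hgL x hxS ξ hξ]

/-- Comparison principle for the dominative `p`-Laplace equation. -/
lemma comparison_principle (hN : 2 ≤ N) {p : ℝ} (hp : 2 ≤ p) {Ω : Set (EucN N)}
    (hΩo : IsOpen Ω) (hΩb : Bornology.IsBounded Ω) {V W : EucN N → ℝ}
    (hVc : ContinuousOn V (closure Ω)) (hWc : ContinuousOn W (closure Ω))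
    (hV : IsViscSubsol p Ω V) (hW : IsViscSupersol p Ω W)
    (hbd : ∀ y ∈ frontier Ω, V y ≤ W y) : ∀ x ∈ closure Ω, V x ≤ W x := by
  obtain ⟨c, hc⟩ := (hΩb.isCompact_closure.image_of_continuousOn hWc).bddBelow
  have := comparison_of_one_le hN hp hΩo hΩb (V := fun x => V x + (1 - c))
    (W := fun x => W x + (1 - c)) (hVc.add continuousOn_const)
    (hWc.add continuousOn_const) (hV.add_const (1 - c)) (hW.add_const (1 - c))
    (fun y hy => by
      have := hc (mem_image_of_mem W (subset_closure hy))
      linarith)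
    fun y hy => by linarith [hbd y hy]
  intro x hx
  linarith [this x hx]

lemma nonempty_compl_of_isBounded (hN : 2 ≤ N) {Ω : Set (EucN N)} (hΩb : Bornology.IsBounded Ω) :
    Ωᶜ.Nonempty := by
  obtain ⟨ξ, hξ⟩ := exists_norm_eq_one hN
  have : Nontrivial (EucN N) := ⟨ξ, 0, fun h => by simp [h] at hξ⟩
  rw [nonempty_compl]
  rintro rfl
  exact NormedSpace.unbounded_univ ℝ (EucN N) hΩb

lemma IsViscSupersol.congr {p : ℝ} {Ω : Set (EucN N)} {V W : EucN N → ℝ}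
    (hV : IsViscSupersol p Ω V) (h : EqOn V W Ω) : IsViscSupersol p Ω W :=
  fun x₀ hx₀ φ hφ h0 hlt => hV x₀ hx₀ φ hφ (by rw [h0, h hx₀])
    fun x hx hne => by rw [h hx]; exact hlt x hx hne

/-- main convergence theorem: `ū = u̲ = u` on `Ω`, where `u` is the
unique viscosity solution of `D_p u = 0` in `Ω` with `u = F` on `∂Ω`, and `u_ε → u`
uniformly on `closure Ω` as `ε → 0`. -/
theorem main_convergence (hN : 2 ≤ N) (p q : ℝ) (hp : 2 ≤ p)
    (hq : q = ((N : ℝ) + 2) / ((N : ℝ) + p))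
    (Ω : Set (EucN N)) (hΩo : IsOpen Ω) (hΩb : Bornology.IsBounded Ω)
    (hΩc : IsConnected Ω) (δbar μ : ℝ) (hδbar : 0 < δbar) (hμ : μ ∈ Ioo (0 : ℝ) 1)
    (hΩlip : Corkscrew Ω δbar μ)
    (F : EucN N → ℝ) (K : ℝ≥0) (hF : LipschitzOnWith K F Ωᶜ)
    (u : ℝ → EucN N → ℝ) (hu : ∀ ε : ℝ, 0 < ε → IsMVS q ε Ω F (u ε)) :
    ∃ U : EucN N → ℝ,
      ContinuousOn U (closure Ω) ∧
      IsViscSubsol p Ω U ∧ IsViscSupersol p Ω U ∧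
      EqOn U F (frontier Ω) ∧
      (∀ W : EucN N → ℝ, ContinuousOn W (closure Ω) → IsViscSubsol p Ω W →
        IsViscSupersol p Ω W → EqOn W F (frontier Ω) → EqOn W U (closure Ω)) ∧
      (∀ x ∈ Ω, ubarF Ω u x = U x ∧ ulowF Ω u x = U x) ∧
      TendstoUniformlyOn (fun ε => u ε) U (𝓝[>] (0 : ℝ)) (closure Ω) := by
  obtain ⟨A, -, hA⟩ := exists_uniform_bound hN hp hq hΩb hF (nonempty_compl_of_isBounded hN hΩb) hu
  have hb : LocBdd Ω u := ⟨A, K, hA⟩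
  have hequi := fun (η : ℝ) (hη : 0 < η) =>
    asymptotic_equicontinuity hN hp hq hΩo hΩb hδbar hμ hΩlip hF hu hη
  have hc : ContinuousOn (ubarF Ω u) (closure Ω) := continuousOn_ubarF hb hequi
  have hc' : ContinuousOn (ubarF Ω fun ε x => -u ε x) (closure Ω) :=
    continuousOn_ubarF hb.neg fun η hη => by
      obtain ⟨δ, hδ, h⟩ := hequi η hη
      refine ⟨δ, hδ, fun ε h0 h1 x hx y hy hd => ?_⟩
      have := h ε h0 h1 y hy x hx (by rwa [dist_comm])
      linarith
  have hlow : ulowF Ω u = fun x => -ubarF Ω (fun ε y => -u ε y) x :=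
    funext (ulowF_eq_neg_ubarF Ω u)
  have hlc : ContinuousOn (ulowF Ω u) (closure Ω) := by rw [hlow]; exact hc'.neg
  have hsub := isViscSubsol_ubarF hN hp hq hΩo hΩb hu hb hc
  have hsup := isViscSupersol_ulowF hN hp hq hΩo hΩb hu hb hc'
  have hbdry : ∀ y ∈ frontier Ω, ubarF Ω u y = F y := fun y hy =>
    ubarF_eq_of_boundary hb hy.1 fun η hη => by
      obtain ⟨δ, hδ, h⟩ := boundary_estimate hN hp hq hΩo hΩb hδbar hμ hΩlip hF hu hη
      exact ⟨δ, hδ, fun ε h0 h1 x hx hd => h ε h0 h1 y hy x hx hd⟩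
  have hbdry' : ∀ y ∈ frontier Ω, ulowF Ω u y = F y := fun y hy => by
    rw [ulowF_eq_neg_ubarF, neg_eq_iff_eq_neg]
    refine ubarF_eq_of_boundary (F := fun y => -F y) hb.neg hy.1 fun η hη => ?_
    obtain ⟨δ, hδ, h⟩ := boundary_estimate hN hp hq hΩo hΩb hδbar hμ hΩlip hF hu hη
    refine ⟨δ, hδ, fun ε h0 h1 x hx hd => ?_⟩
    rw [← abs_neg, neg_sub, sub_neg_eq_add, neg_add_eq_sub]
    exact h ε h0 h1 y hy x hx hd
  have heq : EqOn (ulowF Ω u) (ubarF Ω u) (closure Ω) := fun x hx =>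
    (ulowF_le_ubarF hb hx).antisymm (comparison_principle hN hp hΩo hΩb hc hlc hsub hsup
      (fun y hy => by rw [hbdry y hy, hbdry' y hy]) x hx)
  have hsup' := hsup.congr (heq.mono subset_closure)
  refine ⟨ubarF Ω u, hc, hsub, hsup', hbdry, fun W hWc hW1 hW2 hWF x hx => ?_,
    fun x hx => ⟨rfl, heq (subset_closure hx)⟩, ?_⟩
  · exact le_antisymm
      (comparison_principle hN hp hΩo hΩb hWc hc hW1 hsup'
        (fun y hy => by rw [hbdry y hy, hWF hy]) x hx)
      (comparison_principle hN hp hΩo hΩb hc hWc hsub hW2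
        (fun y hy => by rw [hbdry y hy, hWF hy]) x hx)
  · rw [Metric.tendstoUniformlyOn_iff]
    intro η hη
    have hcpt := hΩb.isCompact_closure
    obtain ⟨δ₁, hδ₁, h1⟩ := eventually_le_of_ubarF_lt hb hcpt Subset.rfl
      (ψ := fun y => ubarF Ω u y + η / 2) (hc.add continuousOn_const)
      fun y _ => by linarith
    obtain ⟨δ₂, hδ₂, h2⟩ := eventually_le_of_ubarF_lt hb.neg hcpt Subset.rfl
      (ψ := fun y => -ubarF Ω u y + η / 2) (hc.neg.add continuousOn_const)
      fun y hy => by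
        have := heq hy
        rw [ulowF_eq_neg_ubarF] at this
        linarith
    filter_upwards [Ioo_mem_nhdsGT (lt_min hδ₁ hδ₂)] with ε hε x hx
    have h3 := h1 ε hε.1 (hε.2.trans_le (min_le_left _ _)) x hx
    have h4 := h2 ε hε.1 (hε.2.trans_le (min_le_right _ _)) x hx
    rw [Real.dist_eq, abs_lt]
    constructor <;> linarith

end
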